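/- arXiv:2001.04764 — 7 statements merged into one kernel-verified Lean document; each statement's English description precedes it below -/
import Mathlib

section
/- Let p be an odd prime, r a positive integer, q = p^r, and g a positive integer. Let ζ_1, …, ζ_{2g} be complex roots of unity and let s be their period, i.e. the least positive integer with ζ_i^s = 1 for all i. Assume that a_k := -q^{k/2}·∑_{i=1}^{2g} ζ_i^k is a rational integer for every positive integer k. Let n be a positive integer, m = gcd(n, s), and t = n/m. Then: (i) if m·r is even, a_n = q^{(n-m)/2}·a_m; (ii) if m·r is odd and p ∤ t, a_n = q^{(n-m)/2}·a_m·(((-1)^{(t-1)/2}·t)/p), where (·/p) is the Legendre symbol; (iii) if m·r is odd and p ∣ t, a_n = q^{(n-m)/2}·a_m. -/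
open Polynomial in
/-- Integer polynomial relations at a root of unity are preserved by `μ ↦ μ ^ u`
for `u` prime to the order. -/
theorem IsPrimitiveRoot.aeval_pow_eq_intCast {N : ℕ} {μ : ℂ} (hμ : IsPrimitiveRoot μ N)
    (hN : 0 < N) {u : ℕ} (hu : u.Coprime N) {P : ℤ[X]} {c : ℤ} (h : aeval μ P = c) :
    aeval (μ ^ u) P = c := by
  have hdvd : minpoly ℤ μ ∣ P - C c :=
    minpoly.isIntegrallyClosed_dvd (hμ.isIntegral hN) (by simp [h])
  rw [hμ.minpoly_eq_pow_coprime hu] at hdvd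
  obtain ⟨Q, hQ⟩ := hdvd
  have := congrArg (aeval (μ ^ u)) hQ
  simpa [sub_eq_zero] using this

/-- The sign by which the automorphism raising roots of unity to the power `u` acts on `√p`. -/
def sqrtPrimeSign (p : ℕ) [Fact p.Prime] (u : ℕ) : ℤ :=
  legendreSym p ((-1) ^ ((u - 1) / 2) * (u : ℤ))

theorem sqrtPrimeSign_eq_mul (p : ℕ) [Fact p.Prime] (u : ℕ) :
    sqrtPrimeSign p u = legendreSym p (-1) ^ ((u - 1) / 2) * legendreSym p u := by
  rw [sqrtPrimeSign, legendreSym.mul]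
  congr 1
  exact map_pow (legendreSym.hom p) (-1) _

theorem legendreSym_neg_one_of_mod_four_ne_three {p : ℕ} [Fact p.Prime] (hp : p ≠ 2)
    (h : p % 4 ≠ 3) : legendreSym p (-1) = 1 := by
  rw [legendreSym.at_neg_one hp, ZMod.χ₄_nat_one_mod_four]
  have := (Fact.out : p.Prime).mod_two_eq_one_iff_ne_two.2 hp
  lia

theorem legendreSym_neg_one_of_mod_four_eq_three {p : ℕ} [Fact p.Prime] (h : p % 4 = 3) :
    legendreSym p (-1) = -1 := by
  rw [legendreSym.at_neg_one (by rintro rfl; simp at h), ZMod.χ₄_nat_three_mod_four h]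

theorem legendreSym_congr {p : ℕ} [Fact p.Prime] {u t : ℕ} (h : u ≡ t [MOD p]) :
    legendreSym p u = legendreSym p t := by
  rw [legendreSym, legendreSym]
  congr 1
  simpa using (ZMod.natCast_eq_natCast_iff u t p).2 h

theorem sqrtPrimeSign_sq {p : ℕ} [Fact p.Prime] {u : ℕ} (hu : ¬ p ∣ u) :
    sqrtPrimeSign p u ^ 2 = 1 := by
  apply legendreSym.sq_one
  simpa [ZMod.natCast_eq_zero_iff] using hu

open Polynomial in
/-- The quadratic Gauss sum attached to a `p`-th root of unity `ω`, as a polynomial in `ω`. -/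
noncomputable def gaussPoly (p : ℕ) [Fact p.Prime] : ℤ[X] :=
  ∑ a : ZMod p, C (quadraticChar (ZMod p) a) * X ^ a.val

open Polynomial in
theorem gaussPoly_aeval_pow {p : ℕ} [Fact p.Prime] {ω : ℂ} (hω : IsPrimitiveRoot ω p) {u : ℕ}
    (hu : ¬ p ∣ u) : aeval (ω ^ u) (gaussPoly p) = legendreSym p u * aeval ω (gaussPoly p) := by
  set χ : MulChar (ZMod p) ℂ := (quadraticChar (ZMod p)).ringHomComp (Int.castRingHom ℂ)
  set ψ := AddChar.zmodChar p hω.pow_eq_one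
  have hu0 : (u : ZMod p) ≠ 0 := by simpa [ZMod.natCast_eq_zero_iff] using hu
  have h1 : aeval ω (gaussPoly p) = gaussSum χ ψ := by
    simp [gaussPoly, gaussSum, χ, ψ, AddChar.zmodChar_apply]
  have h2 : aeval (ω ^ u) (gaussPoly p) = gaussSum χ (ψ.mulShift (Units.mk0 _ hu0 : (ZMod p)ˣ)) := by
    simp only [gaussPoly, gaussSum, map_sum, map_mul, aeval_C, map_pow, aeval_X]
    refine Finset.sum_congr rfl fun a _ ↦ ?_
    rw [AddChar.mulShift_apply, Units.val_mk0, ← nsmul_eq_mul, AddChar.map_nsmul_eq_pow,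
      AddChar.zmodChar_apply, pow_right_comm]
    simp [χ]
  have h3 := gaussSum_mulShift χ ψ (Units.mk0 _ hu0)
  rw [← h2, ← h1, Units.val_mk0] at h3
  have hχ : χ (u : ZMod p) = legendreSym p u := by simp [χ, legendreSym]
  have hsq : (legendreSym p u : ℂ) * legendreSym p u = 1 := by
    rw [← sq]
    exact_mod_cast legendreSym.sq_one p (a := u) (by simpa using hu0)
  rw [← h3, hχ, ← mul_assoc, hsq, one_mul]

open Polynomial in
theorem gaussPoly_aeval_sq {p : ℕ} [Fact p.Prime] (hp : p ≠ 2) {ω : ℂ}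
    (hω : IsPrimitiveRoot ω p) :
    aeval ω (gaussPoly p) ^ 2 = legendreSym p (-1) * p := by
  set χ : MulChar (ZMod p) ℂ := (quadraticChar (ZMod p)).ringHomComp (Int.castRingHom ℂ)
  have h1 : aeval ω (gaussPoly p) = gaussSum χ (AddChar.zmodChar p hω.pow_eq_one) := by
    simp [gaussPoly, gaussSum, χ, AddChar.zmodChar_apply]
  rw [h1, gaussSum_sq ((MulChar.ringHomComp_ne_one_iff Int.cast_injective).2
    (quadraticChar_ne_one (by rwa [ZMod.ringChar_zmod_n])))
    ((quadraticChar_isQuadratic _).comp _) (AddChar.zmodChar_primitive_of_primitive_root p hω)]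
  simp [legendreSym, ZMod.card]

open Polynomial in
/-- A square root of the odd prime `p` is an integer polynomial in any primitive `N`-th root of
unity with `4 p ∣ N`, with explicit Galois action. -/
theorem exists_sqrtPrime_poly {p : ℕ} [Fact p.Prime] (hp : p ≠ 2) {N : ℕ} (hN : 0 < N)
    (hpN : 4 * p ∣ N) {μ : ℂ} (hμ : IsPrimitiveRoot μ N) :
    ∃ B : ℤ[X], aeval μ B ^ 2 = p ∧
      ∀ u : ℕ, u.Coprime N → aeval (μ ^ u) B = sqrtPrimeSign p u * aeval μ B := by
  obtain ⟨M, rfl⟩ := hpN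
  have hω : IsPrimitiveRoot (μ ^ (4 * M)) p := hμ.pow hN (by ring)
  have hndvd : ∀ u : ℕ, u.Coprime (4 * p * M) → ¬ p ∣ u := fun u hu h ↦
    Nat.not_coprime_of_dvd_of_dvd (Fact.out : p.Prime).one_lt h ⟨4 * M, by ring⟩ hu
  have hG : ∀ u : ℕ, u.Coprime (4 * p * M) → aeval (μ ^ u) ((gaussPoly p).comp (X ^ (4 * M)))
      = legendreSym p u * aeval (μ ^ (4 * M)) (gaussPoly p) := fun u hu ↦ by
    rw [aeval_comp, map_pow, aeval_X, pow_right_comm, gaussPoly_aeval_pow hω (hndvd u hu)]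
  by_cases h3 : p % 4 = 3
  · have hi : (μ ^ (p * M)) ^ 2 = -1 := by
      rw [← pow_mul]
      exact (hμ.pow hN (by ring) : IsPrimitiveRoot (μ ^ (p * M * 2)) 2).eq_neg_one_of_two_right
    refine ⟨X ^ (p * M) * (gaussPoly p).comp (X ^ (4 * M)), ?_, fun u hu ↦ ?_⟩
    · simp only [map_mul, mul_pow, map_pow, aeval_X, aeval_comp, hi, gaussPoly_aeval_sq hp hω,
        legendreSym_neg_one_of_mod_four_eq_three h3]
      simp
    · rw [map_mul, hG u hu, sqrtPrimeSign_eq_mul, legendreSym_neg_one_of_mod_four_eq_three h3]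
      simp only [map_mul, map_pow, aeval_X, aeval_comp]
      have hodd : Odd u := by
        rw [← Nat.coprime_two_right]
        exact hu.coprime_dvd_right ⟨2 * p * M, by ring⟩
      obtain ⟨v, rfl⟩ := hodd
      rw [pow_right_comm, pow_succ, pow_mul, hi, show (2 * v + 1 - 1) / 2 = v by lia]
      push_cast
      ring
  · refine ⟨(gaussPoly p).comp (X ^ (4 * M)), ?_, fun u hu ↦ ?_⟩
    · simp only [map_pow, aeval_X, aeval_comp, gaussPoly_aeval_sq hp hω,
        legendreSym_neg_one_of_mod_four_ne_three hp h3]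
      simp
    · rw [hG u hu, sqrtPrimeSign_eq_mul, legendreSym_neg_one_of_mod_four_ne_three hp h3]
      simp [aeval_comp]

open Polynomial in
/-- If `√p ^ k` times a sum of `d`-th roots of unity is an integer, then raising these roots
to the power `u` multiplies the sum by the `k`-th power of the sign of `u`. -/
theorem sum_pow_eq_sqrtPrimeSign_pow_mul {ι : Type*} [Fintype ι] {p : ℕ} [Fact p.Prime]
    (hp : p ≠ 2) {d k : ℕ} (hd : 0 < d) {z : ι → ℂ} (hz : ∀ i, z i ^ d = 1) {A : ℤ}
    (hA : ((√p : ℝ) : ℂ) ^ k * ∑ i, z i = A) {t u : ℕ} (hu : u.Coprime (4 * p * d))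
    (hut : u ≡ t [MOD d]) : ∑ i, z i ^ t = (sqrtPrimeSign p u : ℂ) ^ k * ∑ i, z i := by
  have hp0 : 0 < p := (Fact.out : p.Prime).pos
  have hN : 0 < 4 * p * d := by positivity
  have : NeZero (4 * p * d) := ⟨hN.ne'⟩
  have hμ := Complex.isPrimitiveRoot_exp (4 * p * d) hN.ne'
  set μ := Complex.exp (2 * Real.pi * Complex.I / (4 * p * d : ℕ))
  obtain ⟨B, hB, hBu⟩ := exists_sqrtPrime_poly hp hN ⟨d, rfl⟩ hμ
  have hexp : ∀ i, ∃ e < 4 * p * d, μ ^ e = z i := fun i ↦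
    hμ.eq_pow_of_pow_eq_one (by rw [mul_comm, pow_mul, hz, one_pow])
  choose e _ he using hexp
  have hS : aeval μ (∑ i, (X : ℤ[X]) ^ e i) = ∑ i, z i := by simp [he]
  have hSu : aeval (μ ^ u) (∑ i, (X : ℤ[X]) ^ e i) = ∑ i, z i ^ t := by
    simp only [map_sum, map_pow, aeval_X]
    refine Finset.sum_congr rfl fun i _ ↦ ?_
    rw [pow_right_comm, he]
    exact pow_eq_pow_of_modEq hut (hz i)
  have hsqrt : ((√p : ℝ) : ℂ) ^ 2 = p := by
    rw [← Complex.ofReal_pow, Real.sq_sqrt (by positivity), Complex.ofReal_natCast]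
  have hint : ∃ c : ℤ, aeval μ (B ^ k * ∑ i, (X : ℤ[X]) ^ e i) = c := by
    rw [map_mul, map_pow, hS]
    rcases sq_eq_sq_iff_eq_or_eq_neg.1 (hB.trans hsqrt.symm) with h | h
    · exact ⟨A, by rw [h, hA]⟩
    · exact ⟨(-1) ^ k * A, by rw [h, neg_pow, mul_assoc, hA]; push_cast; rfl⟩
  obtain ⟨c, hc⟩ := hint
  have hcu := hμ.aeval_pow_eq_intCast hN hu hc
  rw [← hc, map_mul, map_mul, map_pow, map_pow, hS, hSu, hBu u hu, mul_pow] at hcu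
  have hB0 : aeval μ B ^ k ≠ 0 := by
    refine pow_ne_zero _ fun h ↦ ?_
    rw [h, zero_pow two_ne_zero] at hB
    exact hp0.ne (by exact_mod_cast hB)
  have hndvd : ¬ p ∣ u := fun h ↦
    Nat.not_coprime_of_dvd_of_dvd (Fact.out : p.Prime).one_lt h ⟨4 * d, by ring⟩ hu
  have hsign : (sqrtPrimeSign p u : ℂ) ^ k * (sqrtPrimeSign p u : ℂ) ^ k = 1 := by
    rw [← mul_pow, ← sq]
    exact_mod_cast by rw [sqrtPrimeSign_sq hndvd, one_pow]
  apply mul_left_cancel₀ hB0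
  linear_combination (sqrtPrimeSign p u : ℂ) ^ k * hcu - aeval μ B ^ k * (∑ i, z i ^ t) * hsign

theorem sqrtPrimeSign_pow_of_odd {p : ℕ} [Fact p.Prime] {u k : ℕ} (hu : ¬ p ∣ u) (hk : Odd k) :
    sqrtPrimeSign p u ^ k = sqrtPrimeSign p u := by
  obtain ⟨l, rfl⟩ := hk
  rw [pow_succ, pow_mul, sqrtPrimeSign_sq hu, one_pow, one_mul]

/-- An odd representative of a residue class prime to `d`. -/
theorem Nat.Coprime.exists_odd_modEq {p d t : ℕ} (hp : Odd p) (ht : t.Coprime d) :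
    ∃ v, Odd v ∧ v.Coprime d ∧ v ≡ t [MOD p * d] := by
  rcases Nat.even_or_odd t with he | ho
  · have hd : Odd d := Nat.Coprime.odd_of_left (ht.coprime_dvd_left he.two_dvd)
    exact ⟨t + p * d, he.add_odd (hp.mul hd), by simpa using ht, by simp [Nat.ModEq]⟩
  · exact ⟨t, ho, ht, rfl⟩

theorem Nat.coprime_four_mul_mul {p d u : ℕ} (hp : p.Prime) (hu : Odd u) (hup : ¬ p ∣ u)
    (hud : u.Coprime d) : u.Coprime (4 * p * d) := by
  refine Nat.Coprime.mul_right (Nat.Coprime.mul_right ?_ ?_) hud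
  · exact Nat.Coprime.pow_right 2 (Nat.coprime_two_right.2 hu)
  · exact ((Nat.Prime.coprime_iff_not_dvd hp).2 hup).symm

theorem Nat.Coprime.exists_coprime_modEq_of_not_dvd {p d v a : ℕ} (hp : p.Prime) (hp2 : p ≠ 2)
    (hpd : ¬ p ∣ d) (hpa : ¬ p ∣ a) (hv : Odd v) (hvd : v.Coprime d) :
    ∃ u, u.Coprime (4 * p * d) ∧ u ≡ v [MOD 4 * d] ∧ u ≡ a [MOD p] := by
  have hcop : (4 * d).Coprime p := Nat.Coprime.mul_left
    (Nat.Coprime.pow_left 2 ((Nat.coprime_primes Nat.prime_two hp).2 hp2.symm))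
    ((Nat.Prime.coprime_iff_not_dvd hp).2 hpd).symm
  obtain ⟨u, hu, hua⟩ := Nat.chineseRemainder hcop v a
  refine ⟨u, Nat.coprime_four_mul_mul hp ?_ ?_ ?_, hu, hua⟩
  · have := hu.of_mul_right d
    rw [Nat.odd_iff] at *
    unfold Nat.ModEq at this
    lia
  · rwa [hua.dvd_iff dvd_rfl]
  · have := (hu.of_mul_left 4).gcd_eq
    rwa [Nat.Coprime, this]

theorem Nat.Coprime.exists_coprime_modEq {p d t : ℕ} (hp : p.Prime) (hp2 : p ≠ 2)
    (ht : t.Coprime d) : ∃ u, u.Coprime (4 * p * d) ∧ u ≡ t [MOD d] := by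
  obtain ⟨v, hv, hvd, hvt⟩ := ht.exists_odd_modEq (hp.odd_of_ne_two hp2)
  by_cases hpv : p ∣ v
  · have hpd : ¬ p ∣ d := fun h ↦ Nat.not_coprime_of_dvd_of_dvd hp.one_lt hpv h hvd
    obtain ⟨u, hu, huv, -⟩ := Nat.Coprime.exists_coprime_modEq_of_not_dvd hp hp2 hpd
      (a := 1) (by simpa using hp.one_lt.ne') hv hvd
    exact ⟨u, hu, (huv.of_mul_left 4).trans (hvt.of_mul_left p)⟩
  · exact ⟨v, Nat.coprime_four_mul_mul hp hv hpv hvd, hvt.of_mul_left p⟩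

section

variable {ι : Type*} [Fintype ι] {p : ℕ} [Fact p.Prime] {d k t : ℕ} {z : ι → ℂ} {A : ℤ}

theorem sum_pow_eq_sum_of_even (hp : p ≠ 2) (hd : 0 < d) (hz : ∀ i, z i ^ d = 1)
    (hA : ((√p : ℝ) : ℂ) ^ k * ∑ i, z i = A) (ht : t.Coprime d) (hk : Even k) :
    ∑ i, z i ^ t = ∑ i, z i := by
  have hpp : p.Prime := Fact.out
  obtain ⟨u, hu, hut⟩ := ht.exists_coprime_modEq hpp hp
  have hndvd : ¬ p ∣ u := fun h ↦
    Nat.not_coprime_of_dvd_of_dvd hpp.one_lt h ⟨4 * d, by ring⟩ hu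
  obtain ⟨l, rfl⟩ := hk.two_dvd
  have hsq : (sqrtPrimeSign p u : ℂ) ^ 2 = 1 := by exact_mod_cast sqrtPrimeSign_sq hndvd
  rw [sum_pow_eq_sqrtPrimeSign_pow_mul hp hd hz hA hu hut, pow_mul, hsq, one_pow, one_mul]

theorem sum_pow_eq_sqrtPrimeSign_mul_of_odd (hp : p ≠ 2) (hd : 0 < d) (hz : ∀ i, z i ^ d = 1)
    (hA : ((√p : ℝ) : ℂ) ^ k * ∑ i, z i = A) (hk : Odd k) {u : ℕ}
    (hu : u.Coprime (4 * p * d)) (hut : u ≡ t [MOD d]) :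
    ∑ i, z i ^ t = sqrtPrimeSign p u * ∑ i, z i := by
  have hndvd : ¬ p ∣ u := fun h ↦
    Nat.not_coprime_of_dvd_of_dvd (Fact.out : p.Prime).one_lt h ⟨4 * d, by ring⟩ hu
  rw [sum_pow_eq_sqrtPrimeSign_pow_mul hp hd hz hA hu hut, ← Int.cast_pow,
    sqrtPrimeSign_pow_of_odd hndvd hk]

/-- Two automorphisms agreeing on `d`-th roots of unity but not on `√p` force the sum to
vanish. -/
theorem sum_eq_zero_of_sqrtPrimeSign_eq_neg (hp : p ≠ 2) (hd : 0 < d) (hz : ∀ i, z i ^ d = 1)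
    (hA : ((√p : ℝ) : ℂ) ^ k * ∑ i, z i = A) (hk : Odd k) {u v : ℕ}
    (hu : u.Coprime (4 * p * d)) (hv : v.Coprime (4 * p * d)) (huv : u ≡ v [MOD d])
    (hsign : sqrtPrimeSign p u = -sqrtPrimeSign p v) : ∑ i, z i = 0 := by
  have h1 := sum_pow_eq_sqrtPrimeSign_mul_of_odd hp hd hz hA hk hu huv
  have h2 := sum_pow_eq_sqrtPrimeSign_mul_of_odd hp hd hz hA hk hv rfl
  have hndvd : ¬ p ∣ v := fun h ↦
    Nat.not_coprime_of_dvd_of_dvd (Fact.out : p.Prime).one_lt h ⟨4 * d, by ring⟩ hv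
  have hsq : (sqrtPrimeSign p v : ℂ) ^ 2 = 1 := by exact_mod_cast sqrtPrimeSign_sq hndvd
  rw [hsign] at h1
  push_cast at h1
  linear_combination (sqrtPrimeSign p v : ℂ) / 2 * (h1 - h2) - (∑ i, z i) * hsq

theorem sum_eq_zero_of_dvd (hp : p ≠ 2) (hd : 0 < d) (hz : ∀ i, z i ^ d = 1)
    (hA : ((√p : ℝ) : ℂ) ^ k * ∑ i, z i = A) (ht : t.Coprime d) (hk : Odd k) (hpt : p ∣ t) :
    ∑ i, z i = 0 := by
  have hpp : p.Prime := Fact.out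
  have hpd : ¬ p ∣ d := fun h ↦ Nat.not_coprime_of_dvd_of_dvd hpp.one_lt hpt h ht
  obtain ⟨b, hb⟩ := quadraticChar_exists_neg_one (F := ZMod p) (by rwa [ZMod.ringChar_zmod_n])
  have hbL : legendreSym p b.val = -1 := by simpa [legendreSym] using hb
  have hpb : ¬ p ∣ b.val := by
    rw [← ZMod.natCast_eq_zero_iff, ZMod.natCast_zmod_val]
    rintro rfl
    simp at hb
  obtain ⟨u, hu, hu4, hua⟩ := Nat.Coprime.exists_coprime_modEq_of_not_dvd hpp hp hpd hpb
    odd_one (Nat.coprime_one_left d)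
  have h1 : Nat.Coprime 1 (4 * p * d) := Nat.coprime_one_left _
  refine sum_eq_zero_of_sqrtPrimeSign_eq_neg hp hd hz hA hk hu h1 (hu4.of_mul_left 4) ?_
  have hmod : u % 4 = 1 := hu4.of_mul_right d
  rw [sqrtPrimeSign_eq_mul, sqrtPrimeSign_eq_mul, legendreSym_congr hua, hbL]
  obtain ⟨l, hl⟩ : 2 ∣ (u - 1) / 2 := by lia
  have hsq : legendreSym p (-1) ^ 2 = 1 := legendreSym.sq_one p (by simp)
  simp [hl, pow_mul, hsq]

theorem sum_pow_eq_sqrtPrimeSign_mul_of_not_dvd (hp : p ≠ 2) (hd : 0 < d)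
    (hz : ∀ i, z i ^ d = 1) (hA : ((√p : ℝ) : ℂ) ^ k * ∑ i, z i = A) (ht : t.Coprime d)
    (hk : Odd k) (hpt : ¬ p ∣ t) : ∑ i, z i ^ t = sqrtPrimeSign p t * ∑ i, z i := by
  have hpp : p.Prime := Fact.out
  have hpo : Odd p := hpp.odd_of_ne_two hp
  rcases Nat.even_or_odd t with he | ho
  · have hd2 : Odd d := Nat.Coprime.odd_of_left (ht.coprime_dvd_left he.two_dvd)
    have hcop : ∀ c : ℕ, Odd c → (t + c * (p * d)).Coprime (4 * p * d) := fun c hc ↦ by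
      refine Nat.coprime_four_mul_mul hpp (he.add_odd (hc.mul (hpo.mul hd2))) ?_ ?_
      · rwa [Nat.dvd_add_left ⟨c * d, by ring⟩]
      · rw [← mul_assoc]
        simpa using ht
    have hleg : ∀ c : ℕ, legendreSym p (t + c * (p * d) : ℕ) = legendreSym p t := fun c ↦
      legendreSym_congr (by
        rw [Nat.ModEq, show c * (p * d) = p * (c * d) by ring, Nat.add_mul_mod_self_left])
    have hmod : ∀ c : ℕ, t + c * (p * d) ≡ t [MOD d] := fun c ↦ by
      rw [Nat.ModEq, ← mul_assoc, Nat.add_mul_mod_self_right]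
    by_cases h3 : p % 4 = 3
    · have h0 : ∑ i, z i = 0 := by
        refine sum_eq_zero_of_sqrtPrimeSign_eq_neg hp hd hz hA hk (hcop 3 (by decide))
          (hcop 1 odd_one) ((hmod 3).trans (hmod 1).symm) ?_
        rw [sqrtPrimeSign_eq_mul, sqrtPrimeSign_eq_mul, hleg, hleg,
          legendreSym_neg_one_of_mod_four_eq_three h3]
        have hpd : Odd (p * d) := hpo.mul hd2
        rw [show (t + 3 * (p * d) - 1) / 2 = (t + 1 * (p * d) - 1) / 2 + p * d by
          have := hpd.pos; lia, pow_add, hpd.neg_one_pow]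
        ring
      rw [sum_pow_eq_sqrtPrimeSign_mul_of_odd hp hd hz hA hk (hcop 1 odd_one) (hmod 1), h0,
        mul_zero, mul_zero]
    · rw [sum_pow_eq_sqrtPrimeSign_mul_of_odd hp hd hz hA hk (hcop 1 odd_one) (hmod 1),
        sqrtPrimeSign_eq_mul, sqrtPrimeSign_eq_mul, hleg,
        legendreSym_neg_one_of_mod_four_ne_three hp h3, one_pow, one_pow]
  · exact sum_pow_eq_sqrtPrimeSign_mul_of_odd hp hd hz hA hk
      (Nat.coprime_four_mul_mul hpp ho hpt ht) rfl

end

/-- Reduction theorem for supersingular curves in odd characteristic: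
if `a k = -q^{k/2} * ∑ ζ_i^k` is an integer for all `k ≥ 1`, where the `ζ_i` are
roots of unity with period `s`, then `a n` is determined by `a m` for `m = gcd(n,s)`. -/
theorem reduction_theorem_odd_char
    (p r g : ℕ) [Fact p.Prime] (hodd : Odd p) (hr : 0 < r) (hg : 0 < g)
    (q : ℕ) (hq : q = p ^ r)
    (ζ : Fin (2 * g) → ℂ) (hζ : ∀ i, ∃ k : ℕ, 0 < k ∧ ζ i ^ k = 1)
    (s : ℕ) (hs : 0 < s) (hsζ : ∀ i, ζ i ^ s = 1)
    (hsmin : ∀ s' : ℕ, 0 < s' → (∀ i, ζ i ^ s' = 1) → s ≤ s')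
    (a : ℕ → ℤ)
    (ha : ∀ k : ℕ, 0 < k → (a k : ℂ) = -((Real.sqrt q : ℝ) : ℂ) ^ k * ∑ i, ζ i ^ k)
    (n m t : ℕ) (hn : 0 < n) (hm : m = Nat.gcd n s) (ht : t = n / m) :
    (Even (m * r) → (a n : ℝ) = Real.sqrt q ^ (n - m) * a m) ∧
    (Odd (m * r) → ¬ p ∣ t →
      (a n : ℝ) = Real.sqrt q ^ (n - m) * a m *
        (legendreSym p ((-1) ^ ((t - 1) / 2) * (t : ℤ)) : ℝ)) ∧
    (Odd (m * r) → p ∣ t → (a n : ℝ) = Real.sqrt q ^ (n - m) * a m) := by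
  have hp2 : p ≠ 2 := by rintro rfl; exact absurd hodd (by decide)
  have hmpos : 0 < m := hm ▸ Nat.gcd_pos_of_pos_left s hn
  have hmn : m ∣ n := hm ▸ Nat.gcd_dvd_left n s
  have hms : m ∣ s := hm ▸ Nat.gcd_dvd_right n s
  obtain ⟨d, rfl⟩ := hms
  have hd : 0 < d := Nat.pos_of_mul_pos_left hs
  have hnt : n = m * t := by rw [ht, Nat.mul_div_cancel' hmn]
  have htd : t.Coprime d := by
    rw [hnt, Nat.gcd_mul_left] at hm
    exact Nat.eq_of_mul_eq_mul_left hmpos (by rw [← hm, mul_one])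
  have hz : ∀ i, (ζ i ^ m) ^ d = 1 := fun i ↦ by rw [← pow_mul, hsζ]
  have hsqrt : √(q : ℝ) = √(p : ℝ) ^ r := by
    rw [hq, Nat.cast_pow]
    refine (Real.sqrt_eq_iff_eq_sq (by positivity) (by positivity)).2
      (by rw [pow_right_comm, Real.sq_sqrt (by positivity)])
  have hA : ((√p : ℝ) : ℂ) ^ (m * r) * ∑ i, ζ i ^ m = (-a m : ℤ) := by
    rw [Int.cast_neg, ha m hmpos, hsqrt, Complex.ofReal_pow, ← pow_mul, mul_comm m r]
    ring
  have key : ∀ e : ℤ, ∑ i, (ζ i ^ m) ^ t = e * ∑ i, ζ i ^ m →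
      (a n : ℝ) = √q ^ (n - m) * a m * e := fun e he ↦ by
    have h : (a n : ℂ) = (√q : ℝ) ^ (n - m) * a m * e := by
      rw [ha n hn, ha m hmpos, ← Nat.sub_add_cancel (Nat.le_of_dvd hn hmn), pow_add,
        Nat.add_sub_cancel, Nat.sub_add_cancel (Nat.le_of_dvd hn hmn)]
      simp only [hnt, pow_mul, he]
      ring
    exact_mod_cast h
  refine ⟨fun h ↦ ?_, fun h hpt ↦ ?_, fun h hpt ↦ ?_⟩
  · simpa using key 1 (by simpa using sum_pow_eq_sum_of_even hp2 hd hz hA htd h)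
  · exact key _ (sum_pow_eq_sqrtPrimeSign_mul_of_not_dvd hp2 hd hz hA htd h hpt)
  · obtain ⟨u, hu, hut⟩ := htd.exists_coprime_modEq Fact.out hp2
    have h0 := sum_eq_zero_of_dvd hp2 hd hz hA htd h hpt
    have hpow := sum_pow_eq_sqrtPrimeSign_mul_of_odd hp2 hd hz hA h hu hut
    simpa using key 1 (by rw [hpow, h0, mul_zero, mul_zero])
end

section
/- Let r be a positive integer, q = 2^r, and g a positive integer. Let ζ_1, …, ζ_{2g} be complex roots of unity and let s be their period, i.e. the least positive integer with ζ_i^s = 1 for all i. Assume that a_k := -q^{k/2}·∑_{i=1}^{2g} ζ_i^k is a rational integer for every positive integer k. Let n be a positive integer, m = gcd(n, s), and t = n/m. Then: (i) if m·r is even, a_n = q^{(n-m)/2}·a_m; (ii) if m·r is odd, a_n = q^{(n-m)/2}·a_m·(−1)^{(t²−1)/8}. -/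
/-- A primitive root of unity and its powers of coprime exponent are roots of the same integer
polynomials. -/
theorem IsPrimitiveRoot.aeval_pow_eq_zero {N u : ℕ} {μ : ℂ} (hμ : IsPrimitiveRoot μ N)
    (hN : 0 < N) (hu : u.Coprime N) {P : Polynomial ℤ} (hP : Polynomial.aeval μ P = 0) :
    Polynomial.aeval (μ ^ u) P = 0 := by
  obtain ⟨Q, rfl⟩ := minpoly.isIntegrallyClosed_dvd (hμ.isIntegral hN) hP
  rw [hμ.minpoly_eq_pow_coprime hu, map_mul, minpoly.aeval, zero_mul]

/-- A sum of roots of unity whose product with a power of `√2` is an integer, and the effect on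
that product of raising the roots to a coprime power. -/
theorem intCast_eq_neg_sqrt_two_pow_mul_sum_pow {ι : Type*} [Fintype ι] {d u e : ℕ} (hd : 0 < d)
    (hu : u.Coprime (8 * d)) {w ε : ℂ} (hw : IsPrimitiveRoot w 8)
    (hw1 : w + w ^ 7 = (Real.sqrt 2 : ℝ)) (hε : w ^ u + (w ^ u) ^ 7 = ε * (Real.sqrt 2 : ℝ))
    (x : ι → ℂ) (hx : ∀ i, x i ^ d = 1) {c : ℤ}
    (hc : (c : ℂ) = -((Real.sqrt 2 : ℝ) : ℂ) ^ e * ∑ i, x i) :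
    (c : ℂ) = -(ε * (Real.sqrt 2 : ℝ)) ^ e * ∑ i, x i ^ u := by
  have hN : 0 < 8 * d := by positivity
  have hμ := Complex.isPrimitiveRoot_exp (8 * d) hN.ne'
  set μ := Complex.exp (2 * Real.pi * Complex.I / ((8 * d : ℕ) : ℂ))
  have : NeZero (8 * d) := ⟨hN.ne'⟩
  have hroot (y : ℂ) (hy : y ^ (8 * d) = 1) : ∃ j, μ ^ j = y := by
    obtain ⟨j, -, hj⟩ := hμ.eq_pow_of_pow_eq_one hy
    exact ⟨j, hj⟩
  obtain ⟨l, rfl⟩ := hroot w (by rw [pow_mul, hw.pow_eq_one, one_pow])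
  choose j hj using fun i ↦ hroot (x i) (by rw [mul_comm, pow_mul, hx, one_pow])
  have key := hμ.aeval_pow_eq_zero hN hu (P := Polynomial.C c +
    (Polynomial.X ^ l + (Polynomial.X ^ l) ^ 7) ^ e * ∑ i, Polynomial.X ^ j i) (by
      simp [hj, hw1, hc])
  have hcomm (k : ℕ) : (μ ^ u) ^ k = (μ ^ k) ^ u := pow_right_comm _ _ _
  simp only [map_add, map_mul, map_pow, map_sum, Polynomial.aeval_X, map_intCast,
    hcomm, hj, hε, eq_intCast] at key
  linear_combination key

/-- The primitive eighth root of unity `(1 + i) / √2`, and `√2` as a sum of powers of it. -/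
theorem exists_isPrimitiveRoot_eight_add_pow_seven_eq_sqrt_two :
    ∃ w : ℂ, IsPrimitiveRoot w 8 ∧ w ^ 4 = -1 ∧ w + w ^ 7 = (Real.sqrt 2 : ℝ) := by
  have h2 : ((Real.sqrt 2 : ℝ) : ℂ) ^ 2 = 2 := by
    rw [← Complex.ofReal_pow, Real.sq_sqrt (by norm_num)]; norm_num
  have hI := Complex.I_sq
  set v : ℂ := ((Real.sqrt 2 : ℝ) : ℂ)
  have hw2 : (v / 2 * (1 + Complex.I)) ^ 2 = Complex.I := by
    linear_combination (1 + Complex.I) ^ 2 / 4 * h2 + hI / 2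
  have hw4 : (v / 2 * (1 + Complex.I)) ^ 4 = -1 := by
    rw [show (4 : ℕ) = 2 * 2 from rfl, pow_mul, hw2, hI]
  refine ⟨v / 2 * (1 + Complex.I), ?_, hw4, ?_⟩
  · refine IsPrimitiveRoot.iff_orderOf.2
      (orderOf_eq_prime_pow (p := 2) (n := 2) ?_ ?_)
    · norm_num [hw4]
    · rw [show 2 ^ (2 + 1) = 4 * 2 from rfl, pow_mul, hw4]; norm_num
  · rw [show v / 2 * (1 + Complex.I) + (v / 2 * (1 + Complex.I)) ^ 7 = v / 2 * (1 + Complex.I) *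
      (1 + (v / 2 * (1 + Complex.I)) ^ 2 * (v / 2 * (1 + Complex.I)) ^ 4) by ring, hw2, hw4]
    linear_combination -v / 2 * hI

/-- Raising the primitive eighth root `w` to the power `u` multiplies `w + w⁷` by `1` or `-1`,
according to the class of `u` modulo `8`. -/
theorem pow_add_pow_pow_seven_eq {w : ℂ} (hw4 : w ^ 4 = -1) (u : ℕ) :
    (u % 8 = 1 ∨ u % 8 = 7 → w ^ u + (w ^ u) ^ 7 = 1 * (w + w ^ 7)) ∧
    (u % 8 = 3 ∨ u % 8 = 5 → w ^ u + (w ^ u) ^ 7 = -1 * (w + w ^ 7)) := by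
  have hw8 : w ^ 8 = 1 := by
    rw [show (8 : ℕ) = 4 * 2 from rfl, pow_mul, hw4]; norm_num
  rw [pow_eq_pow_mod u hw8]
  constructor <;> rintro (h | h) <;> rw [h] <;> ring_nf <;>
    simp only [show w ^ 49 = (w ^ 8) ^ 6 * w by ring, show w ^ 21 = (w ^ 8) ^ 2 * w ^ 4 * w by ring,
      show w ^ 35 = (w ^ 8) ^ 4 * w ^ 3 by ring, show w ^ 7 = w ^ 4 * w ^ 3 by ring,
      show w ^ 5 = w ^ 4 * w by ring, hw8, hw4] <;> ring

/-- The exponent `(t² - 1) / 8` is even for `t ≡ ±1` and odd for `t ≡ ±3` modulo `8`. -/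
theorem neg_one_pow_sq_sub_one_div_eight (t : ℕ) :
    (t % 8 = 1 ∨ t % 8 = 7 → (-1 : ℝ) ^ ((t ^ 2 - 1) / 8) = 1) ∧
    (t % 8 = 3 ∨ t % 8 = 5 → (-1 : ℝ) ^ ((t ^ 2 - 1) / 8) = -1) := by
  obtain ⟨k, j, hj, rfl⟩ : ∃ k j, j < 8 ∧ t = 8 * k + j :=
    ⟨t / 8, t % 8, Nat.mod_lt _ (by norm_num), (Nat.div_add_mod t 8).symm⟩
  have hsq (c : ℕ) (h : (j ^ 2 - 1) = 8 * c) (hj : 1 ≤ j ^ 2) :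
      ((8 * k + j) ^ 2 - 1) / 8 = 2 * (4 * k ^ 2 + k * j) + c := by
    have : (8 * k + j) ^ 2 = 8 * (2 * (4 * k ^ 2 + k * j)) + j ^ 2 := by ring
    omega
  constructor <;> rintro (h | h)
  · obtain rfl : j = 1 := by omega
    rw [hsq 0 rfl (by norm_num)]; simp
  · obtain rfl : j = 7 := by omega
    rw [hsq 6 rfl (by norm_num), pow_add, pow_mul]; norm_num
  · obtain rfl : j = 3 := by omega
    rw [hsq 1 rfl (by norm_num), pow_add, pow_mul]; norm_num
  · obtain rfl : j = 5 := by omega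
    rw [hsq 3 rfl (by norm_num), pow_add, pow_mul]; norm_num


/-- Reduction theorem for supersingular curves in characteristic 2:
if `a k = -q^{k/2} * ∑ ζ_i^k` is an integer for all `k ≥ 1`, where the `ζ_i` are
roots of unity with period `s`, then `a n` is determined by `a m` for `m = gcd(n,s)`. -/
theorem reduction_theorem_char_two
    (r g : ℕ) (hr : 0 < r) (hg : 0 < g)
    (q : ℕ) (hq : q = 2 ^ r)
    (ζ : Fin (2 * g) → ℂ) (hζ : ∀ i, ∃ k : ℕ, 0 < k ∧ ζ i ^ k = 1)
    (s : ℕ) (hs : 0 < s) (hsζ : ∀ i, ζ i ^ s = 1)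
    (hsmin : ∀ s' : ℕ, 0 < s' → (∀ i, ζ i ^ s' = 1) → s ≤ s')
    (a : ℕ → ℤ)
    (ha : ∀ k : ℕ, 0 < k → (a k : ℂ) = -((Real.sqrt q : ℝ) : ℂ) ^ k * ∑ i, ζ i ^ k)
    (n m t : ℕ) (hn : 0 < n) (hm : m = Nat.gcd n s) (ht : t = n / m) :
    (Even (m * r) → (a n : ℝ) = Real.sqrt q ^ (n - m) * a m) ∧
    (Odd (m * r) →
      (a n : ℝ) = Real.sqrt q ^ (n - m) * a m * (-1 : ℝ) ^ ((t ^ 2 - 1) / 8)) := by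
  have hmpos : 0 < m := hm ▸ Nat.gcd_pos_of_pos_left s hn
  obtain ⟨d, hd⟩ : m ∣ s := hm ▸ Nat.gcd_dvd_right n s
  have hnt : n = m * t := by
    rw [ht, Nat.mul_div_cancel' (hm ▸ Nat.gcd_dvd_left n s)]
  have hdpos : 0 < d := Nat.pos_of_mul_pos_left (hd ▸ hs)
  have htpos : 0 < t := Nat.pos_of_mul_pos_left (hnt ▸ hn)
  have htd : t.Coprime d := by
    have h := Nat.gcd_mul_left m t d
    rw [← hnt, ← hd, ← hm] at h
    exact Nat.eq_of_mul_eq_mul_left hmpos (by rw [mul_one]; exact h.symm)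
  have hmn : n - m + m = n := Nat.sub_add_cancel (hnt ▸ Nat.le_mul_of_pos_right m htpos)
  have hsqrt : Real.sqrt q = Real.sqrt 2 ^ r := by
    rw [hq, Nat.cast_pow, Nat.cast_ofNat]
    rw [show (2 : ℝ) ^ r = (Real.sqrt 2 ^ r) ^ 2 by
      rw [pow_right_comm, Real.sq_sqrt (by norm_num)], Real.sqrt_sq (by positivity)]
  obtain ⟨w, hw, hw4, hw1⟩ := exists_isPrimitiveRoot_eight_add_pow_seven_eq_sqrt_two
  have main (u : ℕ) (hu8 : u.Coprime 8) (hut : u ≡ t [MOD d]) (ε : ℝ)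
      (hε : w ^ u + (w ^ u) ^ 7 = ε * (w + w ^ 7)) (hε2 : ε * ε = 1) :
      (a n : ℝ) = Real.sqrt q ^ (n - m) * a m * ε ^ (m * r) := by
    have hud : u.Coprime d := by rw [Nat.Coprime, hut.gcd_eq]; exact htd
    have hxd (i) : (ζ i ^ m) ^ d = 1 := by rw [← pow_mul, ← hd, hsζ]
    have h := intCast_eq_neg_sqrt_two_pow_mul_sum_pow (e := m * r) hdpos
      (Nat.Coprime.mul_right hu8 hud) hw hw1 (hw1 ▸ hε) (fun i ↦ ζ i ^ m) hxd (c := a m) (by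
        rw [ha m hmpos, hsqrt]; push_cast; rw [← pow_mul, mul_comm r])
    have hpow (i) : (ζ i ^ m) ^ u = ζ i ^ n := by
      rw [hnt, pow_mul, pow_eq_pow_mod u (hxd i), hut, ← pow_eq_pow_mod t (hxd i)]
    simp only [hpow] at h
    have hεε : (ε : ℂ) ^ (m * r) * (ε : ℂ) ^ (m * r) = 1 := by
      rw [← mul_pow, ← Complex.ofReal_mul, hε2, Complex.ofReal_one, one_pow]
    have hq' : ((Real.sqrt q : ℝ) : ℂ) ^ m = ((Real.sqrt 2 : ℝ) : ℂ) ^ (m * r) := by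
      rw [hsqrt, Complex.ofReal_pow, ← pow_mul, mul_comm r]
    rw [← Complex.ofReal_inj]
    push_cast
    rw [h, ha n hn, ← hmn, pow_add _ (n - m) m, hmn, hq', mul_pow]
    linear_combination ((Real.sqrt q : ℝ) : ℂ) ^ (n - m) * ((Real.sqrt 2 : ℝ) : ℂ) ^ (m * r) *
      (∑ i, ζ i ^ n) * hεε
  have plus (u : ℕ) (hut : u ≡ t [MOD d]) (hu : u % 8 = 1 ∨ u % 8 = 7) :
      (a n : ℝ) = Real.sqrt q ^ (n - m) * a m := by
    have h8 : u.Coprime 8 := by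
      rw [Nat.Coprime, Nat.gcd_comm, Nat.gcd_rec]; rcases hu with h | h <;> rw [h] <;> rfl
    simpa using main u h8 hut 1 (by simpa using (pow_add_pow_pow_seven_eq hw4 u).1 hu) (by norm_num)
  have minus (u : ℕ) (hut : u ≡ t [MOD d]) (hu : u % 8 = 3 ∨ u % 8 = 5) :
      (a n : ℝ) = Real.sqrt q ^ (n - m) * a m * (-1) ^ (m * r) := by
    have h8 : u.Coprime 8 := by
      rw [Nat.Coprime, Nat.gcd_comm, Nat.gcd_rec]; rcases hu with h | h <;> rw [h] <;> rfl
    exact main u h8 hut (-1) (by simpa using (pow_add_pow_pow_seven_eq hw4 u).2 hu) (by norm_num)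
  rcases Nat.even_or_odd t with hte | hto
  · have hd8 : d.Coprime 8 := by
      have : d.Coprime 2 := (htd.coprime_dvd_left hte.two_dvd).symm
      exact this.pow_right 3
    obtain ⟨u, hut, hu⟩ := Nat.chineseRemainder hd8 t 1
    obtain ⟨v, hvt, hv⟩ := Nat.chineseRemainder hd8 t 3
    have hp := plus u hut (Or.inl hu)
    refine ⟨fun _ ↦ hp, fun hodd ↦ ?_⟩
    have hn' := minus v hvt (Or.inl hv)
    rw [hodd.neg_one_pow] at hn'
    have h0 : Real.sqrt q ^ (n - m) * a m = 0 := by linarith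
    rw [hp, h0, zero_mul]
  · have hcases : (t % 8 = 1 ∨ t % 8 = 7) ∨ (t % 8 = 3 ∨ t % 8 = 5) := by
      have := Nat.odd_iff.1 hto
      omega
    rcases hcases with h | h
    · rw [(neg_one_pow_sq_sub_one_div_eight t).1 h, mul_one]
      exact ⟨fun _ ↦ plus t rfl h, fun _ ↦ plus t rfl h⟩
    · rw [(neg_one_pow_sq_sub_one_div_eight t).2 h]
      have hn' := minus t rfl h
      exact ⟨fun he ↦ by rwa [he.neg_one_pow, mul_one] at hn',
        fun ho ↦ by rwa [ho.neg_one_pow] at hn'⟩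
end

section
/- Let d and n be positive integers, Q = q^d, and let L be a Q-linearized polynomial with coefficients in F_Q (so L induces an F_Q-linear map on F_{Q^n} = F_{q^{dn}}). Let w be the F_Q-dimension of the radical of the quadratic form x ↦ Tr_{F_{Q^n}/F_Q}(x·L(x)), and suppose that #{x ∈ F_{Q^n} : Tr_{F_{Q^n}/F_Q}(x·L(x)) = 0} = Q^{n−1} + λ(Q−1)Q^{(n+w)/2−1} for some λ ∈ {−1, 1}. Then #{x ∈ F_{q^{dn}} : Tr_{F_{q^{dn}}/F_q}(x·L(x)) = 0} = q^{dn−1} + λ(q−1)q^{(dn+dw)/2−1}; that is, the quadratic form Tr_{F_{q^{dn}}/F_q}(x·L(x)) over F_q has the same nonzero sign λ, and its radical has F_q-dimension d·w. -/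
/-- The radical of a quadratic form `Q`: the set of `x` with
`Q(x+y) - Q(x) - Q(y) = 0` for all `y`. -/
def radicalSet {K F : Type*} [CommRing K] [CommRing F] (Q : F → K) : Set F :=
  {x | ∀ y, Q (x + y) - Q x - Q y = 0}

/-- The map induced by the `q`-linearized polynomial `∑ i < N, c i * X ^ q ^ i`. -/
def linPolyMap {K F : Type*} [CommSemiring K] [CommSemiring F] [Algebra K F]
    (q N : ℕ) (c : ℕ → K) (x : F) : F :=
  ∑ i ∈ Finset.range N, algebraMap K F (c i) * x ^ q ^ i

open Finset in
/-- The values of a function on a finite type whose fiber sizes have the prescribed first two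
moments, and prescribed size over `b₀`, are equidistributed away from `b₀`. -/
theorem card_fiber_eq_of_moments {X k : Type*} [Fintype X] [Fintype k] [DecidableEq k]
    (f : X → k) (b₀ : k) (M : ℤ)
    (h₁ : (Fintype.card X : ℤ) = #{x | f x = b₀} + (Fintype.card k - 1) * M)
    (h₂ : (#{z : X × X | f z.1 = f z.2} : ℤ) =
      (#{x | f x = b₀} : ℤ) ^ 2 + (Fintype.card k - 1) * M ^ 2)
    (b : k) (hb : b ≠ b₀) : (#{x | f x = b} : ℤ) = M := by
  have e₁ : (Fintype.card X : ℤ) = ∑ b, (#{x | f x = b} : ℤ) := by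
    rw [← card_univ, card_eq_sum_card_fiberwise (f := f) (t := univ) (by simp)]
    push_cast; rfl
  have e₂ : (#{z : X × X | f z.1 = f z.2} : ℤ) = ∑ b, (#{x | f x = b} : ℤ) ^ 2 := by
    rw [card_eq_sum_card_fiberwise (f := fun z => f z.1) (t := univ) (by simp)]
    push_cast
    refine sum_congr rfl fun b _ => ?_
    rw [sq, ← Nat.cast_mul, ← card_product]
    congr 2
    ext z
    simp only [mem_filter, mem_univ, true_and, mem_product]
    grind
  rw [← add_sum_erase _ _ (mem_univ b₀)] at e₁ e₂
  have hc : (#(univ.erase b₀) : ℤ) = Fintype.card k - 1 := by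
    rw [cast_card_erase_of_mem (mem_univ b₀), card_univ]
  have h0 : ∑ b ∈ univ.erase b₀, ((#{x | f x = b} : ℤ) - M) ^ 2 = 0 := by
    simp only [sub_sq, sum_add_distrib, sum_sub_distrib, ← sum_mul, ← mul_sum, sum_const,
      nsmul_eq_mul, hc]
    linear_combination h₂ - e₂ - 2 * M * (h₁ - e₁)
  have := (sum_eq_zero_iff_of_nonneg fun b _ => sq_nonneg _).1 h0 b (by simp [hb])
  exact sub_eq_zero.1 (pow_eq_zero_iff two_ne_zero |>.1 this)

theorem LinearMap.card_ker_mul_card {k V : Type*} [Field k] [AddCommGroup V] [Module k V]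
    (φ : V →ₗ[k] k) (hφ : φ ≠ 0) : Nat.card (ker φ) * Nat.card k = Nat.card V := by
  rw [Submodule.card_eq_card_quotient_mul_card (ker φ),
    Nat.card_congr (φ.quotKerEquivOfSurjective (LinearMap.surjective hφ)).toEquiv, mul_comm]

open Finset in
theorem LinearMap.BilinForm.card_zeros_mul_card {k V : Type*} [Field k] [Fintype k]
    [DecidableEq k] [AddCommGroup V] [Module k V] [Fintype V] (B : LinearMap.BilinForm k V) :
    (#{z : V × V | B z.1 z.2 = 0} : ℤ) * Fintype.card k =
      Fintype.card V * (Fintype.card V + (Fintype.card k - 1) * Nat.card (ker B)) := by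
  classical
  have key (u : V) : (#{v | B u v = 0} : ℤ) * Fintype.card k =
      Fintype.card V + if B u = 0 then (Fintype.card V * (Fintype.card k - 1) : ℤ) else 0 := by
    split_ifs with h
    · simp only [h, LinearMap.zero_apply, filter_true, card_univ]; ring
    · rw [add_zero, ← Nat.card_eq_fintype_card (α := V), ← LinearMap.card_ker_mul_card _ h,
        Nat.card_eq_fintype_card (α := k), Nat.cast_mul]
      congr 2
      rw [← Fintype.card_subtype, ← Nat.card_eq_fintype_card]
      rfl
  have hR : (#{u | B u = 0}) = Nat.card (ker B) := by
    rw [← Fintype.card_subtype, ← Nat.card_eq_fintype_card]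
    rfl
  have hs : #{z : V × V | B z.1 z.2 = 0} = ∑ u, #{v | B u v = 0} := by
    simp only [card_filter, Fintype.sum_prod_type]
  rw [hs]
  push_cast
  rw [sum_mul, sum_congr rfl fun u _ => key u, sum_add_distrib, ← sum_filter, sum_const,
    sum_const, hR, card_univ, nsmul_eq_mul, nsmul_eq_mul]
  ring

open Finset in
theorem LinearMap.BilinForm.card_apply_self_eq {k V : Type*} [Field k] [DecidableEq k]
    [AddCommGroup V] [Module k V] [Fintype V] (h2 : (2 : k) ≠ 0) (β : LinearMap.BilinForm k V) :
    #{z : V × V | β z.1 z.1 = β z.2 z.2} = #{z : V × V | (β + β.flip) z.1 z.2 = 0} := by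
  refine card_bij' (fun z _ => (z.1 - z.2, z.1 + z.2))
    (fun z _ => ((2 : k)⁻¹ • (z.1 + z.2), (2 : k)⁻¹ • (z.2 - z.1))) ?_ ?_ ?_ ?_
  · rintro ⟨x, y⟩ h
    simp only [mem_filter_univ] at h ⊢
    simp only [LinearMap.add_apply, map_add, map_sub, LinearMap.sub_apply, flip_apply]
    linear_combination 2 * h
  · rintro ⟨u, v⟩ h
    simp only [mem_filter_univ] at h ⊢
    simp only [LinearMap.add_apply, flip_apply] at h
    simp only [map_add, map_sub, map_smul, LinearMap.add_apply, LinearMap.sub_apply,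
      LinearMap.smul_apply, smul_eq_mul]
    linear_combination 2 * (2 : k)⁻¹ ^ 2 * h
  · rintro ⟨x, y⟩ -
    ext1 <;> dsimp only
    · rw [sub_add_add_cancel, ← two_smul k x, smul_smul, inv_mul_cancel₀ h2, one_smul]
    · rw [add_sub_sub_cancel, ← two_smul k y, smul_smul, inv_mul_cancel₀ h2, one_smul]
  · rintro ⟨u, v⟩ -
    ext1 <;> dsimp only
    · rw [← smul_sub, (by abel : u + v - (v - u) = u + u), ← two_smul k u, smul_smul,
        inv_mul_cancel₀ h2, one_smul]
    · rw [← smul_add, (by abel : u + v + (v - u) = v + v), ← two_smul k v, smul_smul,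
        inv_mul_cancel₀ h2, one_smul]

open Finset in
/-- A quadratic form of even rank over a finite field takes all nonzero values equally often. -/
theorem LinearMap.BilinForm.card_apply_self_eq_of_ne_zero {k V : Type*} [Field k] [Fintype k]
    [DecidableEq k] [AddCommGroup V] [Module k V] [Fintype V] (h2 : (2 : k) ≠ 0)
    (β : LinearMap.BilinForm k V) {n w e : ℕ} (hn : 0 < n) {s : ℤ} (hs : s ^ 2 = 1)
    (hV : Fintype.card V = Fintype.card k ^ n)
    (hw : Nat.card (ker (β + β.flip)) = Fintype.card k ^ w) (he : n + w = 2 * (e + 1))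
    (h0 : (#{x | β x x = 0} : ℤ) =
      Fintype.card k ^ (n - 1) + s * (Fintype.card k - 1) * Fintype.card k ^ e)
    {b : k} (hb : b ≠ 0) :
    (#{x | β x x = b} : ℤ) = Fintype.card k ^ (n - 1) - s * Fintype.card k ^ e := by
  obtain ⟨m, rfl⟩ : ∃ m, n = m + 1 := ⟨n - 1, by omega⟩
  rw [Nat.add_sub_cancel] at h0 ⊢
  have hk : (Fintype.card k : ℤ) ≠ 0 := by exact_mod_cast Fintype.card_ne_zero
  refine card_fiber_eq_of_moments (fun x => β x x) 0 _ ?_ ?_ b hb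
  · rw [h0, hV]
    push_cast
    ring
  · have hB := (β + β.flip).card_zeros_mul_card
    rw [← β.card_apply_self_eq h2, hV, hw] at hB
    rw [h0]
    refine mul_right_cancel₀ hk (hB.trans ?_)
    have hpow : (Fintype.card k : ℤ) ^ (m + 1) * Fintype.card k ^ w =
        (Fintype.card k ^ e) ^ 2 * Fintype.card k ^ 2 := by
      rw [← pow_add, he]; ring
    push_cast
    linear_combination ((Fintype.card k : ℤ) - 1) * hpow -
      ((Fintype.card k : ℤ) - 1) * Fintype.card k ^ 2 * (Fintype.card k ^ e) ^ 2 * hs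

/-- The linear map induced by the `|K|`-linearized polynomial `∑ i < N, c i * X ^ |K| ^ i`. -/
noncomputable def linPolyLinearMap {K : Type*} (F : Type*) [Field K] [Fintype K] [Field F]
    [Algebra K F] (N : ℕ) (c : ℕ → K) : F →ₗ[K] F :=
  ∑ i ∈ Finset.range N, c i • (FiniteField.frobeniusAlgHom K F).toLinearMap ^ i

theorem linPolyLinearMap_apply {K F : Type*} [Field K] [Fintype K] [Field F] [Algebra K F]
    (N : ℕ) (c : ℕ → K) (x : F) :
    linPolyLinearMap F N c x = linPolyMap (Fintype.card K) N c x := by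
  simp only [linPolyLinearMap, linPolyMap, LinearMap.sum_apply]
  refine Finset.sum_congr rfl fun i _ => ?_
  rw [LinearMap.smul_apply, Algebra.smul_def, Module.End.pow_apply, AlgHom.coe_toLinearMap,
    FiniteField.coe_frobeniusAlgHom, pow_iterate]

theorem radicalSet_apply_self {k V : Type*} [Field k] [Field V] [Module k V]
    (β : LinearMap.BilinForm k V) :
    radicalSet (fun x => β x x) = LinearMap.ker (β + β.flip) := by
  ext x
  simp only [radicalSet, Set.mem_ofPred_eq, SetLike.mem_coe, LinearMap.mem_ker, LinearMap.ext_iff,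
    LinearMap.add_apply, LinearMap.BilinForm.flip_apply, map_add, LinearMap.zero_apply]
  refine forall_congr' fun y => ?_
  rw [show β x x + β y x + (β x y + β y y) - β x x - β y y = β x y + β y x by ring]

/-- Composing a quadratic form with a field trace does not change its radical. -/
theorem radicalSet_trace_apply_self {K k V : Type*} [Field K] [Field k] [Algebra K k]
    [FiniteDimensional K k] [Algebra.IsSeparable K k] [Field V] [Module k V]
    (β : LinearMap.BilinForm k V) :
    radicalSet (fun x => Algebra.trace K k (β x x)) = LinearMap.ker (β + β.flip) := by
  ext x
  rw [← radicalSet_apply_self]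
  simp only [radicalSet, Set.mem_ofPred_eq, ← map_sub]
  refine ⟨fun h y => ?_, fun h y => by rw [h, map_zero]⟩
  refine (traceForm_nondegenerate K k).1 _ fun a => ?_
  rw [Algebra.traceForm_apply, ← h (a • y)]
  congr 1
  simp only [map_add, map_smul, LinearMap.add_apply, LinearMap.smul_apply, smul_eq_mul]
  ring

/-- If the quadratic form `x ↦ Tr_{F_{Q^n}/F_Q}(x L(x))`, where `Q = q^d` and `L` is
`Q`-linearized with coefficients in `F_Q`, has nonzero sign `λ`, then the quadratic form
`x ↦ Tr_{F_{q^{dn}}/F_q}(x L(x))` has the same sign `λ` and its radical has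
`F_q`-dimension `d·w`. -/
theorem trace_descent_same_sign
    (p r : ℕ) (hp : p.Prime) (hodd : Odd p) (hr : 0 < r)
    (q d n : ℕ) (hq : q = p ^ r) (hd : 0 < d) (hn : 0 < n)
    (Q : ℕ) (hQ : Q = q ^ d)
    (K KQ F : Type) [Field K] [Field KQ] [Field F]
    [Fintype K] [Fintype KQ] [Fintype F]
    [Algebra K KQ] [Algebra KQ F] [Algebra K F] [IsScalarTower K KQ F]
    (hcK : Fintype.card K = q) (hcKQ : Fintype.card KQ = Q) (hcF : Fintype.card F = Q ^ n)
    (N : ℕ) (c : ℕ → KQ)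
    (QfQ : F → KQ) (hQfQ : ∀ x, QfQ x = Algebra.trace KQ F (x * linPolyMap Q N c x))
    (Qfq : F → K) (hQfq : ∀ x, Qfq x = Algebra.trace K F (x * linPolyMap Q N c x))
    (w : ℕ) (hw : w = Module.finrank KQ (Submodule.span KQ (radicalSet QfQ)))
    (lam : ℤ) (hlam : lam = 1 ∨ lam = -1)
    (e : ℕ) (he : n + w = 2 * (e + 1))
    (hcount : ({x : F | QfQ x = 0}.ncard : ℤ) = Q ^ (n - 1) + lam * (Q - 1) * Q ^ e) :
    ({x : F | Qfq x = 0}.ncard : ℤ) =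
        q ^ (d * n - 1) + lam * (q - 1) * q ^ (d * (e + 1) - 1) ∧
      Module.finrank K (Submodule.span K (radicalSet Qfq)) = d * w := by
  classical
  subst hcKQ
  have h2 : (2 : KQ) ≠ 0 := fun h => by
    have hc : ringChar KQ = 2 :=
      CharP.ringChar_of_prime_eq_zero Nat.prime_two (by exact_mod_cast h)
    have h1 := FiniteField.even_card_of_char_two hc
    rw [hQ, hq] at h1
    exact absurd (hodd.pow.pow : Odd ((p ^ r) ^ d)) (Nat.not_odd_iff.2 h1)
  let β : LinearMap.BilinForm KQ F :=
    (Algebra.traceForm KQ F).compl₂ (linPolyLinearMap F N c)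
  have hβ : QfQ = fun x => β x x := funext fun x => by
    rw [hQfQ, ← linPolyLinearMap_apply]; rfl
  have htr : Qfq = fun x => Algebra.trace K KQ (β x x) := funext fun x => by
    rw [hQfq, ← Algebra.trace_trace (S := KQ), ← hQfQ, hβ]
  have hfr : Module.finrank K KQ = d := by
    have h := Module.card_eq_pow_finrank (K := K) (V := KQ)
    rw [hQ, hcK] at h
    exact (Nat.pow_right_injective (hcK ▸ Fintype.one_lt_card) h).symm
  set R := LinearMap.ker (β + β.flip)
  have hwR : w = Module.finrank KQ R := by
    rw [hw, hβ, radicalSet_apply_self, Submodule.span_eq]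
  refine ⟨?_, ?_⟩
  · have hs : lam ^ 2 = 1 := by rcases hlam with rfl | rfl <;> norm_num
    have hRcard : Nat.card R = Fintype.card KQ ^ w := by
      rw [Nat.card_eq_fintype_card, Module.card_eq_pow_finrank (K := KQ), ← hwR]
    have h0 : (Finset.card {x | β x x = 0} : ℤ) =
        Fintype.card KQ ^ (n - 1) + lam * (Fintype.card KQ - 1) * Fintype.card KQ ^ e := by
      rw [← hcount, hβ, Set.ncard_eq_toFinset_card']
      simp
    have hb (b : KQ) (hb : b ≠ 0) := β.card_apply_self_eq_of_ne_zero h2 hn hs hcF hRcard he h0 hb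
    have hker := (Algebra.trace K KQ).card_ker_mul_card (Algebra.trace_ne_zero K KQ)
    have hkerc : Nat.card (LinearMap.ker (Algebra.trace K KQ)) =
        Finset.card {b : KQ | Algebra.trace K KQ b = 0} := by
      rw [← Fintype.card_subtype, ← Nat.card_eq_fintype_card]
      rfl
    rw [hkerc, Nat.card_eq_fintype_card, Nat.card_eq_fintype_card, hcK, hQ] at hker
    have hsum : ({x : F | Qfq x = 0}.ncard : ℤ) =
        ∑ b ∈ {b : KQ | Algebra.trace K KQ b = 0}, (Finset.card {x | β x x = b} : ℤ) := by
      rw [htr, Set.ncard_eq_toFinset_card', Finset.card_eq_sum_card_fiberwise (f := fun x => β x x)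
        (t := {b : KQ | Algebra.trace K KQ b = 0}) (fun x => by simp)]
      push_cast
      refine Finset.sum_congr rfl fun b hb => ?_
      congr 2
      ext x
      simp only [Finset.mem_filter, Finset.mem_univ, true_and, Set.mem_toFinset,
        Set.mem_ofPred_eq] at hb ⊢
      grind
    have hmem : (0 : KQ) ∈ ({b : KQ | Algebra.trace K KQ b = 0} : Finset KQ) := by simp
    rw [hsum, ← Finset.add_sum_erase _ _ hmem, h0,
      Finset.sum_congr rfl fun b h => hb b (Finset.ne_of_mem_erase h),
      Finset.sum_const, nsmul_eq_mul, Finset.cast_card_erase_of_mem hmem, hQ]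
    obtain ⟨m, rfl⟩ : ∃ m, n = m + 1 := ⟨n - 1, by omega⟩
    obtain ⟨a, rfl⟩ : ∃ a, d = a + 1 := ⟨d - 1, by omega⟩
    have hq0 : q ≠ 0 := by rw [hq]; exact pow_ne_zero _ hp.ne_zero
    rw [pow_succ q a, Nat.mul_left_inj hq0] at hker
    rw [hker, Nat.add_sub_cancel, show (a + 1) * (m + 1) - 1 = a + (a + 1) * m by
      rw [mul_add, mul_one]; omega, show (a + 1) * (e + 1) - 1 = a + (a + 1) * e by
      rw [mul_add, mul_one]; omega]
    push_cast
    simp only [pow_add, pow_mul, pow_one]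
    ring
  · rw [htr, radicalSet_trace_apply_self, hwR, ← hfr, Module.finrank_mul_finrank,
      ← Submodule.coe_restrictScalars K, Submodule.span_eq]
    rfl
end

section
/- Let L be a q-linearized polynomial with coefficients in F_q, let n be a positive integer, and let ℓ be a prime with gcd(ℓ, 2p) = 1. If both signs λ_n and λ_{nℓ} lie in {−1, 1}, then λ_n ≡ λ_{nℓ}·q^{(n(ℓ−1) + w_{nℓ} − w_n)/2} (mod ℓ). -/
open Finset in
theorem card_sqrts_add_card_sqrts_mul_nonsquare {K : Type*} [Field K] [Fintype K] [DecidableEq K]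
    (hK : ringChar K ≠ 2) {g : K} (hg : ¬ IsSquare g) (c : K) :
    #{b : K | b ^ 2 = c} + #{b : K | b ^ 2 = g * c} = 2 := by
  have h (a : K) : (#{b : K | b ^ 2 = a} : ℤ) = quadraticChar K a + 1 := by
    rw [← quadraticChar_card_sqrts hK a]
    congr 2
    ext b
    simp
  have hχ : quadraticChar K g = -1 := quadraticChar_neg_one_iff_not_isSquare.mpr hg
  zify
  rw [h, h, map_mul, hχ]
  ring

open Finset in
/-- A map that is homogeneous of degree two takes the values `1` and `g`, for a nonsquare `g`,
equally often on average as it takes an arbitrary nonzero value. -/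
theorem card_sub_one_mul_card_fibers_of_homogeneous {K V : Type*} [Field K] [Fintype K]
    [DecidableEq K] [AddCommGroup V] [Module K V] [Fintype V] (hK : ringChar K ≠ 2) {g : K}
    (hg : ¬ IsSquare g) (Q : V → K) (hQ : ∀ (b : K) x, Q (b • x) = b ^ 2 * Q x) :
    (Fintype.card K - 1) * (#{x | Q x = 1} + #{x | Q x = g}) = 2 * #{x | Q x ≠ 0} := by
  have hg0 : g ≠ 0 := by
    rintro rfl
    exact hg IsSquare.zero
  have scale (b : K) (hb : b ≠ 0) (a : K) : #{x | Q x = a} = #{x | b ^ 2 * Q x = a} := by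
    refine (card_equiv (MulAction.toPerm (Units.mk0 b hb)) fun x ↦ ?_).symm
    simp [Units.smul_def, hQ]
  have hcard : #((univ : Finset K).erase 0) = Fintype.card K - 1 := by
    rw [card_erase_of_mem (mem_univ _), card_univ]
  calc
    _ = ∑ b ∈ (univ : Finset K).erase 0, ∑ x : V,
        ((if b ^ 2 * Q x = 1 then 1 else 0) + if b ^ 2 * Q x = g then 1 else 0) := by
      rw [← hcard, ← smul_eq_mul, ← sum_const]
      refine sum_congr rfl fun b hb ↦ ?_
      rw [scale b (ne_of_mem_erase hb) 1, scale b (ne_of_mem_erase hb) g, sum_add_distrib,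
        card_filter, card_filter]
    _ = ∑ x : V, if Q x ≠ 0 then 2 else 0 := by
      rw [sum_comm]
      refine sum_congr rfl fun x _ ↦ ?_
      by_cases hx : Q x = 0
      · simp [hx, hg0.symm]
      · rw [if_pos hx, sum_add_distrib, ← card_filter, ← card_filter]
        refine Eq.trans ?_ (card_sqrts_add_card_sqrts_mul_nonsquare hK hg (Q x)⁻¹)
        congr 2 with b
        · simp only [mem_filter, mem_erase, mem_univ, true_and, and_true, ← one_div,
            eq_div_iff hx]
          refine and_iff_right_of_imp fun h ↦ ?_
          rintro rfl
          simp at h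
        · simp only [mem_filter, mem_erase, mem_univ, true_and, and_true, ← div_eq_mul_inv,
            eq_div_iff hx]
          refine and_iff_right_of_imp fun h ↦ ?_
          rintro rfl
          exact hg0 (by simpa using h.symm)
    _ = _ := by
      rw [← sum_filter, sum_const, smul_eq_mul, mul_comm]

open Finset in
/-- The number of zeros of a degree-two homogeneous map determines the size of its fibres over
`1` and a nonsquare `g` together. -/
theorem fiber_sum_eq_of_card_zeros {K V : Type*} [Field K] [Fintype K] [DecidableEq K]
    [AddCommGroup V] [Module K V] [Fintype V] (hK : ringChar K ≠ 2) {g : K}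
    (hg : ¬ IsSquare g) (Q : V → K) (hQ : ∀ (b : K) x, Q (b • x) = b ^ 2 * Q x) {n e : ℕ} {s : ℤ}
    (hV : Fintype.card V = Fintype.card K ^ n) (hn : 0 < n)
    (h0 : ({x | Q x = 0}.ncard : ℤ) =
      Fintype.card K ^ (n - 1) + s * (Fintype.card K - 1) * Fintype.card K ^ e) :
    ((#{x | Q x = 1} + #{x | Q x = g} : ℕ) : ℤ) =
      2 * (Fintype.card K ^ (n - 1) - s * Fintype.card K ^ e) := by
  have hq1 : 1 < Fintype.card K := Fintype.one_lt_card
  have h := card_sub_one_mul_card_fibers_of_homogeneous hK hg Q hQ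
  have hsplit := card_filter_add_card_filter_not (s := (univ : Finset V)) (fun x ↦ Q x = 0)
  rw [card_univ, hV] at hsplit
  have hz : {x | Q x = 0}.ncard = #{x | Q x = 0} := by
    rw [← Set.ncard_coe_finset]
    simp
  rw [hz] at h0
  zify [hq1.le] at h hsplit
  obtain ⟨m, rfl⟩ := Nat.exists_eq_add_of_le' hn
  rw [Nat.add_sub_cancel] at h0 ⊢
  rw [pow_succ] at hsplit
  have hne : (Fintype.card K : ℤ) - 1 ≠ 0 := by lia
  apply mul_left_cancel₀ hne
  push_cast
  rw [h]
  linear_combination 2 * hsplit - 2 * h0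

theorem map_linPolyMap {K F E : Type*} [CommSemiring K] [CommSemiring F] [CommSemiring E]
    [Algebra K F] [Algebra K E] (f : F →ₐ[K] E) (q N : ℕ) (c : ℕ → K) (x : F) :
    f (linPolyMap q N c x) = linPolyMap q N c (f x) := by
  simp [linPolyMap]

theorem linPolyMap_smul {K F : Type*} [Field K] [Fintype K] [CommSemiring F]
    [Algebra K F] (N : ℕ) (c : ℕ → K) (b : K) (x : F) :
    linPolyMap (Fintype.card K) N c (b • x) = b • linPolyMap (Fintype.card K) N c x := by
  simp [linPolyMap, Finset.smul_sum, smul_pow, FiniteField.pow_card_pow]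

theorem FiniteField.mem_range_algebraMap_iff_pow_card {F E : Type*} [Field F] [Field E]
    [Fintype F] [Fintype E] [Algebra F E] (x : E) :
    x ∈ Set.range (algebraMap F E) ↔ x ^ Fintype.card F = x := by
  constructor
  · rintro ⟨y, rfl⟩
    rw [← map_pow, FiniteField.pow_card]
  · intro hx
    rw [IsGalois.mem_range_algebraMap_iff_fixed]
    intro σ
    obtain ⟨i, rfl⟩ := (FiniteField.bijective_frobeniusAlgEquivOfAlgebraic_pow F E).2 σ
    rw [AlgEquiv.coe_pow, FiniteField.coe_frobeniusAlgEquivOfAlgebraic]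
    exact Function.iterate_fixed hx i

/-- The Frobenius of `E` over `F` acts with order `l` on the fibres of `x ↦ Tr(x L(x))` on `E`, with
fixed points in `F`, so fibre sizes over `E` and `F` are congruent modulo `l`. -/
theorem card_trace_linPolyMap_fiber_modEq {K F E : Type*} [Field K] [Field F] [Field E]
    [Fintype F] [Fintype E] [DecidableEq K] [Algebra K F] [Algebra K E] [Algebra F E]
    [IsScalarTower K F E] {l : ℕ} (hl : l.Prime) (hdeg : Module.finrank F E = l)
    (q N : ℕ) (c : ℕ → K) (a : K) :
    Fintype.card {x : E // Algebra.trace K E (x * linPolyMap q N c x) = a} ≡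
      Fintype.card {x : F // l * Algebra.trace K F (x * linPolyMap q N c x) = a} [MOD l] := by
  classical
  have := Fact.mk hl
  let φ : Gal(E/F) := FiniteField.frobeniusAlgEquivOfAlgebraic F E
  have hinv (x : E) : Algebra.trace K E (φ x * linPolyMap q N c (φ x)) =
      Algebra.trace K E (x * linPolyMap q N c x) := by
    have h := map_linPolyMap (φ.restrictScalars K : E →ₐ[K] E) q N c x
    rw [← Algebra.trace_eq_of_algEquiv (φ.restrictScalars K) (x * linPolyMap q N c x)]
    refine congrArg (Algebra.trace K E) ((congrArg (φ x * ·) h.symm).trans ?_)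
    exact (map_mul (φ.restrictScalars K) _ _).symm
  have htr (y : F) : Algebra.trace K E (algebraMap F E y * linPolyMap q N c (algebraMap F E y)) =
      l * Algebra.trace K F (y * linPolyMap q N c y) := by
    have h := map_linPolyMap (IsScalarTower.toAlgHom K F E) q N c y
    rw [IsScalarTower.coe_toAlgHom'] at h
    rw [← h, ← map_mul, ← Algebra.trace_trace (S := F), Algebra.trace_algebraMap, hdeg, map_nsmul,
      nsmul_eq_mul]
  let f : Function.End {x : E // Algebra.trace K E (x * linPolyMap q N c x) = a} :=
    fun x ↦ ⟨φ x, (hinv x).trans x.2⟩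
  have hiter (k : ℕ) (x) : ((f ^ k) x : E) = x ^ Fintype.card F ^ k := by
    induction k with
    | zero => exact (pow_one (x : E)).symm
    | succ k ih =>
      rw [pow_succ', pow_succ, pow_mul, ← ih]
      rfl
  have hf : f ^ l ^ 1 = 1 := by
    funext x
    apply Subtype.ext
    rw [hiter, pow_one, ← hdeg, ← Module.card_eq_pow_finrank, FiniteField.pow_card]
    rfl
  refine (Equiv.Perm.card_fixedPoints_modEq hf).trans ?_
  have hcard : Fintype.card {x : F // l * Algebra.trace K F (x * linPolyMap q N c x) = a} =
      Fintype.card f.fixedPoints := by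
    refine Fintype.card_of_bijective (f := fun y ↦ ⟨⟨algebraMap F E y, (htr y).trans y.2⟩,
      Subtype.ext (φ.commutes y)⟩) ⟨fun y z h ↦ ?_, fun x ↦ ?_⟩
    · simpa [Subtype.ext_iff] using h
    · obtain ⟨y, hy⟩ := (FiniteField.mem_range_algebraMap_iff_pow_card (F := F) (x : E)).mpr
        (congrArg Subtype.val x.2)
      refine ⟨⟨y, ?_⟩, Subtype.ext (Subtype.ext hy)⟩
      rw [← htr, hy]
      exact x.1.2
  rw [hcard]

/-- If `ℓ` is a prime with `gcd(ℓ, 2p) = 1` and the signs `λ_n, λ_{nℓ}` of the quadratic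
forms `Tr(x L(x))` over `F_{q^n}` and `F_{q^{nℓ}}` both lie in `{−1, 1}`, then
`λ_n ≡ λ_{nℓ} · q^{(n(ℓ−1)+w_{nℓ}−w_n)/2} (mod ℓ)`. -/
theorem sign_congruence_mod_ell
    (p r : ℕ) (hp : p.Prime) (hodd : Odd p) (hr : 0 < r)
    (q : ℕ) (hq : q = p ^ r)
    (n l : ℕ) (hn : 0 < n) (hl : l.Prime) (hl2p : Nat.gcd l (2 * p) = 1)
    (K F E : Type) [Field K] [Field F] [Field E]
    [Fintype K] [Fintype F] [Fintype E]
    [Algebra K F] [Algebra K E]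
    (hcK : Fintype.card K = q) (hcF : Fintype.card F = q ^ n)
    (hcE : Fintype.card E = q ^ (n * l))
    (N : ℕ) (c : ℕ → K)
    (Qn : F → K) (hQn : ∀ x, Qn x = Algebra.trace K F (x * linPolyMap q N c x))
    (Qnl : E → K) (hQnl : ∀ x, Qnl x = Algebra.trace K E (x * linPolyMap q N c x))
    (wn wnl : ℕ)
    (hwn : wn = Module.finrank K (Submodule.span K (radicalSet Qn)))
    (hwnl : wnl = Module.finrank K (Submodule.span K (radicalSet Qnl)))
    (lamn lamnl : ℤ) (hlamn : lamn = 1 ∨ lamn = -1) (hlamnl : lamnl = 1 ∨ lamnl = -1)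
    (en el : ℕ) (hen : n + wn = 2 * (en + 1)) (hel : n * l + wnl = 2 * (el + 1))
    (hcn : ({x : F | Qn x = 0}.ncard : ℤ) = q ^ (n - 1) + lamn * (q - 1) * q ^ en)
    (hcnl : ({x : E | Qnl x = 0}.ncard : ℤ) =
      q ^ (n * l - 1) + lamnl * (q - 1) * q ^ el)
    (Ex : ℕ) (hEx : (2 * Ex : ℤ) = (n : ℤ) * ((l : ℤ) - 1) + (wnl : ℤ) - (wn : ℤ)) :
    lamn ≡ lamnl * (q : ℤ) ^ Ex [ZMOD l] := by
  classical
  subst hcK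
  have := Fact.mk hp
  have := Fact.mk hl
  have hcharK : CharP K p := charP_of_card_eq_prime_pow hq
  have hp2 : p ≠ 2 := by
    rintro rfl
    exact absurd hodd (by decide)
  have hl2 : Nat.Coprime l 2 := Nat.Coprime.coprime_mul_right_right hl2p
  have hlp : Nat.Coprime l p := Nat.Coprime.coprime_mul_left_right hl2p
  have hl0 : (l : K) ≠ 0 := by
    rw [Ne, CharP.cast_eq_zero_iff K p]
    intro h
    exact hp.one_lt.ne' (Nat.Coprime.eq_one_of_dvd hlp.symm h)
  have hringChar : ringChar K ≠ 2 := by rwa [ringChar.eq K p]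
  obtain ⟨g, hg⟩ := FiniteField.exists_nonsquare hringChar
  have hq1 : 1 < Fintype.card K := Fintype.one_lt_card
  have hdF : Module.finrank K F = n :=
    Nat.pow_right_injective hq1 ((Module.card_eq_pow_finrank (K := K) (V := F)).symm.trans hcF)
  have hdE : Module.finrank K E = n * l :=
    Nat.pow_right_injective hq1 ((Module.card_eq_pow_finrank (K := K) (V := E)).symm.trans hcE)
  obtain ⟨i⟩ := FiniteField.nonempty_algHom_of_finrank_dvd (F := K) (K := F) (L := E)
    (by rw [hdF, hdE]; exact dvd_mul_right n l)
  algebraize [i.toRingHom]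
  have : IsScalarTower K F E := IsScalarTower.of_algHom i
  have hdEF : Module.finrank F E = l := by
    have h := Module.finrank_mul_finrank K F E
    rw [hdF, hdE] at h
    exact Nat.eq_of_mul_eq_mul_left hn h
  have hmod (a : K) := card_trace_linPolyMap_fiber_modEq hl hdEF (Fintype.card K) N c a
  simp only [← hQn, ← hQnl, Fintype.card_subtype] at hmod
  have homF (b : K) (x : F) : Qn (b • x) = b ^ 2 * Qn x := by
    rw [hQn, hQn, linPolyMap_smul, smul_mul_smul_comm, map_smul, smul_eq_mul, sq]
  have homE (b : K) (x : E) : Qnl (b • x) = b ^ 2 * Qnl x := by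
    rw [hQnl, hQnl, linPolyMap_smul, smul_mul_smul_comm, map_smul, smul_eq_mul, sq]
  have hF := fiber_sum_eq_of_card_zeros (n := n) hringChar hg (fun x ↦ l * Qn x)
    (fun b x ↦ by rw [homF]; ring) hcF hn (by simpa [hl0] using hcn)
  have hE := fiber_sum_eq_of_card_zeros hringChar hg Qnl homE hcE
    (Nat.mul_pos hn hl.pos) hcnl
  have hsum := (hmod 1).add (hmod g)
  rw [← Int.natCast_modEq_iff, hE, hF] at hsum
  have hel' : el = en + Ex := by
    zify at hen hel ⊢
    linarith
  have hql : IsCoprime (Fintype.card K : ℤ) l := by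
    rw [Nat.isCoprime_iff_coprime, hq]
    exact hlp.symm.pow_left r
  have h2l : IsCoprime (2 : ℤ) l := by
    exact_mod_cast Nat.isCoprime_iff_coprime.mpr hl2.symm
  have hfermat : (Fintype.card K : ℤ) ^ (n * l - 1) ≡ (Fintype.card K : ℤ) ^ (n - 1) [ZMOD l] := by
    have hexp : n * l - 1 = n - 1 + (l - 1) * n := by
      obtain ⟨m, rfl⟩ := Nat.exists_eq_add_of_le' hl.pos
      obtain ⟨k, rfl⟩ := Nat.exists_eq_add_of_le' hn
      simp only [Nat.add_sub_cancel]
      have : (k + 1) * (m + 1) = k + m * (k + 1) + 1 := by ring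
      lia
    rw [hexp, pow_add, pow_mul]
    simpa using ((Int.ModEq.pow_card_sub_one_eq_one hl hql).pow n).mul_left
      ((Fintype.card K : ℤ) ^ (n - 1))
  rw [Int.modEq_iff_dvd] at hsum hfermat ⊢
  have key : (l : ℤ) ∣ (2 * (Fintype.card K : ℤ) ^ en) *
      (lamnl * (Fintype.card K : ℤ) ^ Ex - lamn) := by
    rw [hel', pow_add] at hsum
    obtain ⟨u, hu⟩ := hsum
    obtain ⟨v, hv⟩ := hfermat
    exact ⟨u - 2 * v, by linear_combination hu - 2 * hv⟩
  exact (h2l.mul_left hql.pow_left).symm.dvd_of_dvd_mul_left key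
end

section
/- Let b > a ≥ 0 be integers and n a positive integer. The radical of the quadratic form Q_n(x) = Tr_n(x^{q^b+1} − x^{q^a+1}) on F_{q^n}, i.e. the set {x ∈ F_{q^n} : Q_n(x+y) − Q_n(x) − Q_n(y) = 0 for all y ∈ F_{q^n}}, equals {x ∈ F_{q^n} : x^{q^{2b}} − x^{q^{a+b}} − x^{q^{b−a}} + x = 0}. -/
/-- The trace of a finite extension of finite fields is invariant under iterated Frobenius. -/
theorem trace_pow_card_pow {K F : Type*} [Field K] [Field F] [Fintype K] [Fintype F]
    [Algebra K F] (m : ℕ) (x : F) :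
    Algebra.trace K F (x ^ Fintype.card K ^ m) = Algebra.trace K F x := by
  induction m with
  | zero => simp
  | succ m ih =>
    rw [pow_succ, pow_mul, ← ih]
    exact Algebra.trace_eq_of_algEquiv (FiniteField.frobeniusAlgEquivOfAlgebraic K F) _

/-- Iterated Frobenius over a finite field is additive. -/
theorem add_pow_card_pow {K F : Type*} [Field K] [Field F] [Fintype K] [Algebra K F]
    (m : ℕ) (x y : F) :
    (x + y) ^ Fintype.card K ^ m = x ^ Fintype.card K ^ m + y ^ Fintype.card K ^ m := by
  induction m with
  | zero => simp
  | succ m ih =>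
    rw [pow_succ, pow_mul, pow_mul, pow_mul, ih]
    exact map_add (FiniteField.frobeniusAlgHom K F) _ _

/-- Iterated Frobenius on a finite field is surjective. -/
theorem pow_card_pow_surjective {K F : Type*} [Field K] [Field F] [Fintype K] [Fintype F]
    [Algebra K F] (m : ℕ) : Function.Surjective fun x : F ↦ x ^ Fintype.card K ^ m := by
  induction m with
  | zero => exact fun x ↦ ⟨x, by simp⟩
  | succ m ih =>
    intro x
    obtain ⟨y, hy⟩ := (FiniteField.frobeniusAlgEquivOfAlgebraic K F).surjective x
    obtain ⟨z, rfl⟩ := ih y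
    exact ⟨z, by simpa [pow_succ, pow_mul] using hy⟩

/-- The polar form of `x ↦ Tr (x ^ (q ^ b + 1) - x ^ (q ^ a + 1))`, as a trace pairing of a
linearized polynomial in `x` with `y ^ q ^ b`. -/
theorem trace_polar_eq {K F : Type*} [Field K] [Field F] [Fintype K] [Fintype F]
    [Algebra K F] {q a b : ℕ} (hq : Fintype.card K = q) (hab : a ≤ b) (x y : F) :
    Algebra.trace K F ((x + y) ^ (q ^ b + 1) - (x + y) ^ (q ^ a + 1)) -
        Algebra.trace K F (x ^ (q ^ b + 1) - x ^ (q ^ a + 1)) -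
        Algebra.trace K F (y ^ (q ^ b + 1) - y ^ (q ^ a + 1)) =
      Algebra.trace K F
        ((x ^ q ^ (2 * b) - x ^ q ^ (a + b) - x ^ q ^ (b - a) + x) * y ^ q ^ b) := by
  subst hq
  set q := Fintype.card K
  have h₁ : Algebra.trace K F (x ^ q ^ (2 * b) * y ^ q ^ b) =
      Algebra.trace K F (x ^ q ^ b * y) := by
    rw [two_mul, pow_add, pow_mul, ← mul_pow, trace_pow_card_pow]
  have h₂ : Algebra.trace K F (x ^ q ^ (a + b) * y ^ q ^ b) =
      Algebra.trace K F (x ^ q ^ a * y) := by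
    rw [pow_add, pow_mul, ← mul_pow, trace_pow_card_pow]
  have h₃ : Algebra.trace K F (x ^ q ^ (b - a) * y ^ q ^ b) =
      Algebra.trace K F (x * y ^ q ^ a) := by
    rw [← trace_pow_card_pow (b - a) (x * y ^ q ^ a), mul_pow, ← pow_mul, ← pow_add,
      Nat.add_sub_cancel' hab]
  simp only [add_mul, sub_mul, map_add, map_sub, h₁, h₂, h₃]
  simp only [← map_add, ← map_sub, pow_succ _ (q ^ _), q, add_pow_card_pow]
  congr 1
  ring

/-- The radical of the quadratic form `Q_n(x) = Tr_n(x^{q^b+1} − x^{q^a+1})` on `F_{q^n}`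
equals `{x : x^{q^{2b}} − x^{q^{a+b}} − x^{q^{b−a}} + x = 0}`. -/
theorem radical_eq_kernel_of_linearized
    (p r : ℕ) (hp : p.Prime) (hodd : Odd p) (hr : 0 < r)
    (q : ℕ) (hq : q = p ^ r)
    (a b n : ℕ) (hab : a < b) (hn : 0 < n)
    (K F : Type) [Field K] [Field F] [Fintype K] [Fintype F] [Algebra K F]
    (hcK : Fintype.card K = q) (hcF : Fintype.card F = q ^ n)
    (Qf : F → K)
    (hQf : ∀ x, Qf x = Algebra.trace K F (x ^ (q ^ b + 1) - x ^ (q ^ a + 1))) :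
    radicalSet Qf =
      {x : F | x ^ q ^ (2 * b) - x ^ q ^ (a + b) - x ^ q ^ (b - a) + x = 0} := by
  ext x
  simp only [radicalSet, Set.mem_ofPred_eq, hQf, trace_polar_eq hcK hab.le]
  refine ⟨fun h ↦ (traceForm_nondegenerate K F).1 _ fun z ↦ ?_, fun h y ↦ by simp [h]⟩
  obtain ⟨y, rfl⟩ := pow_card_pow_surjective (K := K) b z
  simpa only [Algebra.traceForm_apply, hcK] using h y
end

section
/- Let b > a ≥ 0 be integers and n a positive integer, and let w_n be the F_q-dimension of the radical of the quadratic form Q_n(x) = Tr_n(x^{q^b+1} − x^{q^a+1}) on F_{q^n}. Then w_n = (b+a, n) + (b−a, n) − ((b+a, b−a), n) if ν_p(n) ≤ max{ν_p(b+a), ν_p(b−a)}, and w_n = (b+a, n) + (b−a, n) if ν_p(n) > max{ν_p(b+a), ν_p(b−a)}. (Here, when a = 0 the term (b+a, b−a) is (b, b) = b.) -/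
open Polynomial Module

lemma Nat.Prime.dvd_div_gcd_iff_padicValNat_lt {p t n c : ℕ} (hp : p.Prime) (ht : t ≠ 0)
    (hn : n ≠ 0) (hc : n = t.gcd n * c) : p ∣ c ↔ padicValNat p t < padicValNat p n := by
  have hg : t.gcd n ≠ 0 := Nat.gcd_ne_zero_right hn
  have hc0 : c ≠ 0 := by rintro rfl; exact hn (by simpa using hc)
  have h1 : n.factorization p = (t.gcd n).factorization p + c.factorization p := by
    conv_lhs => rw [hc, Nat.factorization_mul hg hc0]
    rfl
  rw [Nat.factorization_gcd ht hn, Finsupp.inf_apply] at h1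
  rw [← Nat.factorization_def _ hp, ← Nat.factorization_def _ hp,
    hp.dvd_iff_one_le_factorization hc0]
  omega

section LinearMap

variable (K : Type*) [Field K]

/-- `X ^ g - 1` is coprime to `(X ^ (g * c) - 1) / (X ^ g - 1)` if `c` is invertible. -/
lemma isCoprime_X_pow_sub_one_geom_sum (g : ℕ) {c : ℕ} (hc : (c : K) ≠ 0) :
    IsCoprime (X ^ g - 1 : K[X]) (∑ i ∈ Finset.range c, (X ^ g) ^ i) := by
  have h : (X ^ g - 1 : K[X]) ∣ (∑ i ∈ Finset.range c, (X ^ g) ^ i) - (c : K[X]) := by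
    have : (∑ i ∈ Finset.range c, (X ^ g : K[X]) ^ i) - (c : K[X]) =
        ∑ i ∈ Finset.range c, ((X ^ g) ^ i - 1) := by simp
    rw [this]
    exact Finset.dvd_sum fun i _ => sub_one_dvd_pow_sub_one _ i
  obtain ⟨k, hk⟩ := h
  refine ⟨-C ((c : K)⁻¹) * k, C ((c : K)⁻¹), ?_⟩
  have hcc : C ((c : K)⁻¹) * (c : K[X]) = 1 := by
    rw [← C_eq_natCast, ← C_mul, inv_mul_cancel₀ hc, C_1]
  linear_combination C ((c : K)⁻¹) * hk + hcc

variable {V : Type*} [AddCommGroup V] [Module K V]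

lemma finrank_ker_mul_le [FiniteDimensional K V] (A B : End K V) :
    finrank K (LinearMap.ker (A * B)) ≤
      finrank K (LinearMap.ker A) + finrank K (LinearMap.ker B) := by
  let T : LinearMap.ker (A * B) →ₗ[K] LinearMap.ker A :=
    B.restrict fun x hx => by simpa using hx
  have h := LinearMap.finrank_range_add_finrank_ker T
  have h1 : finrank K (LinearMap.range T) ≤ finrank K (LinearMap.ker A) :=
    Submodule.finrank_le _
  have h2 : finrank K (LinearMap.ker T) ≤ finrank K (LinearMap.ker B) := by
    refine LinearMap.finrank_le_finrank_of_injective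
      (f := ((LinearMap.ker (A * B)).subtype.comp (LinearMap.ker T).subtype).codRestrict _
        fun x => ?_) ?_
    · exact congrArg Subtype.val x.2
    · intro x y hxy
      have h := congrArg Subtype.val hxy
      exact Subtype.ext (Subtype.ext h)
  omega

lemma mem_ker_aeval_X_pow_sub_one {φ : End K V} {d : ℕ} {x : V} :
    x ∈ LinearMap.ker (aeval φ (X ^ d - 1 : K[X])) ↔ Function.IsPeriodicPt φ d x := by
  simp [Function.IsPeriodicPt, Function.IsFixedPt, sub_eq_zero, Module.End.pow_apply]

lemma ker_aeval_X_pow_gcd_sub_one (φ : End K V) (m n : ℕ) :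
    LinearMap.ker (aeval φ (X ^ m.gcd n - 1 : K[X])) =
      LinearMap.ker (aeval φ (X ^ m - 1 : K[X])) ⊓ LinearMap.ker (aeval φ (X ^ n - 1 : K[X])) := by
  ext x
  simp only [Submodule.mem_inf, mem_ker_aeval_X_pow_sub_one]
  exact ⟨fun h => ⟨h.trans_dvd (Nat.gcd_dvd_left _ _), h.trans_dvd (Nat.gcd_dvd_right _ _)⟩,
    fun h => h.1.gcd h.2⟩

lemma ker_aeval_mul_congr_left {φ : End K V} {f f' : K[X]} (g : K[X])
    (h : LinearMap.ker (aeval φ f) = LinearMap.ker (aeval φ f')) :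
    LinearMap.ker (aeval φ (f * g)) = LinearMap.ker (aeval φ (f' * g)) := by
  ext x
  have := SetLike.ext_iff.1 h (aeval φ g x)
  simpa using this

lemma ker_aeval_mul_eq_sup {φ : End K V} (f : K[X]) {g u : K[X]}
    (hgu : IsCoprime g u) (h0 : aeval φ (g * u) = 0) :
    LinearMap.ker (aeval φ (f * g)) = LinearMap.ker (aeval φ f) ⊔ LinearMap.ker (aeval φ g) := by
  apply le_antisymm
  · intro x hx
    have hx' : x ∈ LinearMap.ker (aeval φ g) ⊔ LinearMap.ker (aeval φ u) := by
      rw [sup_ker_aeval_eq_ker_aeval_mul_of_coprime φ hgu, h0]; simp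
    obtain ⟨v, hv, w, hw, rfl⟩ := Submodule.mem_sup.1 hx'
    rw [LinearMap.mem_ker] at hv hw
    rw [add_comm]
    refine Submodule.add_mem_sup ?_ hv
    have h1 : aeval φ f w ∈ LinearMap.ker (aeval φ g) := by
      rw [mul_comm] at hx
      have : aeval φ (g * f) v = 0 := by
        rw [mul_comm, map_mul, Module.End.mul_apply, hv, map_zero]
      rw [LinearMap.mem_ker, map_add, this, zero_add, map_mul, Module.End.mul_apply] at hx
      exact hx
    have h2 : aeval φ f w ∈ LinearMap.ker (aeval φ u) := by
      rw [LinearMap.mem_ker, ← Module.End.mul_apply, ← map_mul, mul_comm, map_mul,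
        Module.End.mul_apply, hw, map_zero]
    exact Submodule.disjoint_def.1 (disjoint_ker_aeval_of_isCoprime φ hgu) _ h1 h2
  · refine sup_le (fun x hx => ?_) fun x hx => ?_ <;> rw [LinearMap.mem_ker] at hx ⊢
    · rw [mul_comm, map_mul, Module.End.mul_apply, hx, map_zero]
    · rw [map_mul, Module.End.mul_apply, hx, map_zero]

end LinearMap

section Frobenius

variable (K F : Type*) [Field K] [Field F] [Fintype K] [Algebra K F]

/-- The Frobenius `x ↦ x ^ #K` as a `K`-linear endomorphism of `F`. -/
noncomputable def frobeniusEnd : End K F := (FiniteField.frobeniusAlgHom K F).toLinearMap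

variable {F}

lemma frobeniusEnd_pow_apply (i : ℕ) (x : F) :
    (frobeniusEnd K F ^ i) x = x ^ Fintype.card K ^ i := by
  induction i generalizing x with
  | zero => simp
  | succ i ih =>
    rw [pow_succ', Module.End.mul_apply, ih, pow_succ, pow_mul]
    simp [frobeniusEnd]

lemma frobeniusEnd_pow_mul (i : ℕ) (x y : F) :
    (frobeniusEnd K F ^ i) (x * y) = (frobeniusEnd K F ^ i) x * (frobeniusEnd K F ^ i) y := by
  simp only [frobeniusEnd_pow_apply, mul_pow]

variable [Fintype F]

lemma trace_frobeniusEnd_pow (i : ℕ) (x : F) :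
    Algebra.trace K F ((frobeniusEnd K F ^ i) x) = Algebra.trace K F x := by
  induction i with
  | zero => simp
  | succ i ih =>
    rw [pow_succ', Module.End.mul_apply, ← ih]
    exact Algebra.trace_eq_of_algEquiv (FiniteField.frobeniusAlgEquivOfAlgebraic K F) _

lemma frobeniusEnd_pow_surjective (i : ℕ) :
    Function.Surjective (frobeniusEnd K F ^ i) := by
  refine LinearMap.surjective_of_injective (LinearMap.ker_eq_bot.1 ?_)
  refine LinearMap.ker_eq_bot'.2 fun x hx => ?_
  rw [frobeniusEnd_pow_apply] at hx
  exact eq_zero_of_pow_eq_zero hx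

variable (F) in
lemma finrank_ker_aeval_frobeniusEnd_le {f : K[X]} (hf : f ≠ 0) :
    finrank K (LinearMap.ker (aeval (frobeniusEnd K F) f)) ≤ f.natDegree := by
  classical
  set q := Fintype.card K with hq
  have hq1 : 1 < q := Fintype.one_lt_card
  let P : F[X] := ∑ i ∈ Finset.range (f.natDegree + 1),
    monomial (q ^ i) (algebraMap K F (f.coeff i))
  have hdeg : P.natDegree ≤ q ^ f.natDegree := by
    refine natDegree_sum_le_of_forall_le _ _ fun i hi => (natDegree_monomial_le _).trans ?_
    exact Nat.pow_le_pow_right hq1.le (by simpa [Nat.lt_succ_iff] using hi)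
  have hP : P ≠ 0 := by
    intro h
    have := congrArg (fun g => g.coeff (q ^ f.natDegree)) h
    simp only [P, finsetSum_coeff, coeff_monomial, coeff_zero,
      (Nat.pow_right_injective hq1).eq_iff] at this
    simp [hf] at this
  have hroot (x : F) (hx : aeval (frobeniusEnd K F) f x = 0) : x ∈ P.roots.toFinset := by
    rw [Multiset.mem_toFinset, mem_roots hP, IsRoot.def]
    rw [aeval_eq_sum_range, LinearMap.sum_apply] at hx
    simpa [P, eval_finsetSum, frobeniusEnd_pow_apply, Algebra.smul_def] using hx
  have hcard : Fintype.card (LinearMap.ker (aeval (frobeniusEnd K F) f)) ≤ q ^ f.natDegree := by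
    calc Fintype.card (LinearMap.ker (aeval (frobeniusEnd K F) f))
        = (Finset.univ.filter fun x => aeval (frobeniusEnd K F) f x = 0).card := by
          rw [← Fintype.card_subtype]; rfl
      _ ≤ P.roots.toFinset.card := Finset.card_le_card fun x hx => hroot x (by simpa using hx)
      _ ≤ q ^ f.natDegree :=
          (Multiset.toFinset_card_le _).trans ((card_roots' P).trans hdeg)
  rw [Module.card_eq_pow_finrank (K := K)] at hcard
  exact (Nat.pow_le_pow_iff_right hq1).1 hcard

variable (F) in
lemma aeval_frobeniusEnd_X_pow_finrank_sub_one :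
    aeval (frobeniusEnd K F) (X ^ finrank K F - 1 : K[X]) = 0 := by
  ext x
  simp [frobeniusEnd_pow_apply, ← Module.card_eq_pow_finrank, FiniteField.pow_card]

variable (F) in
lemma finrank_ker_aeval_frobeniusEnd_of_dvd {f : K[X]} (hf : f ∣ X ^ finrank K F - 1) :
    finrank K (LinearMap.ker (aeval (frobeniusEnd K F) f)) = f.natDegree := by
  have hn : 0 < finrank K F := Module.finrank_pos
  obtain ⟨g, hg⟩ := hf
  have h0 : f * g ≠ 0 := by rw [← hg]; exact (monic_X_pow_sub_C 1 hn.ne').ne_zero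
  have hd : f.natDegree + g.natDegree = finrank K F := by
    rw [← natDegree_mul (left_ne_zero_of_mul h0) (right_ne_zero_of_mul h0), ← hg]
    exact natDegree_X_pow_sub_C
  have h1 := finrank_ker_aeval_frobeniusEnd_le K F (left_ne_zero_of_mul h0)
  have h2 := finrank_ker_aeval_frobeniusEnd_le K F (right_ne_zero_of_mul h0)
  have h3 := finrank_ker_mul_le K (aeval (frobeniusEnd K F) f) (aeval (frobeniusEnd K F) g)
  rw [← map_mul, ← hg, aeval_frobeniusEnd_X_pow_finrank_sub_one, LinearMap.ker_zero,
    finrank_top] at h3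
  omega

variable (F) in
lemma ker_aeval_frobeniusEnd_gcd (s : ℕ) :
    LinearMap.ker (aeval (frobeniusEnd K F) (X ^ s.gcd (finrank K F) - 1 : K[X])) =
      LinearMap.ker (aeval (frobeniusEnd K F) (X ^ s - 1 : K[X])) := by
  rw [ker_aeval_X_pow_gcd_sub_one, aeval_frobeniusEnd_X_pow_finrank_sub_one, LinearMap.ker_zero,
    inf_top_eq]

variable (F) in
lemma ker_aeval_frobeniusEnd_mul_gcd (s t : ℕ) :
    LinearMap.ker (aeval (frobeniusEnd K F) ((X ^ s - 1) * (X ^ t - 1) : K[X])) =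
      LinearMap.ker (aeval (frobeniusEnd K F)
        ((X ^ s.gcd (finrank K F) - 1) * (X ^ t.gcd (finrank K F) - 1) : K[X])) := by
  rw [ker_aeval_mul_congr_left K _ (ker_aeval_frobeniusEnd_gcd K F s).symm, mul_comm,
    ker_aeval_mul_congr_left K _ (ker_aeval_frobeniusEnd_gcd K F t).symm, mul_comm]

variable (F) in
lemma finrank_ker_aeval_frobeniusEnd_X_pow_sub_one {d : ℕ} (hd : d ∣ finrank K F) :
    finrank K (LinearMap.ker (aeval (frobeniusEnd K F) (X ^ d - 1 : K[X]))) = d := by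
  rw [finrank_ker_aeval_frobeniusEnd_of_dvd K F]
  · exact natDegree_X_pow_sub_C
  · exact dvd_pow_sub_one_of_dvd hd

variable (F) in
lemma finrank_ker_aeval_frobeniusEnd_mul_of_natCast_ne_zero {h g c : ℕ}
    (hh : h ∣ finrank K F) (hg : finrank K F = g * c) (hc : (c : K) ≠ 0) :
    finrank K (LinearMap.ker (aeval (frobeniusEnd K F) ((X ^ h - 1) * (X ^ g - 1) : K[X]))) =
      h + g - h.gcd g := by
  have hgn : g ∣ finrank K F := ⟨c, hg⟩
  have h0 : aeval (frobeniusEnd K F)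
      ((X ^ g - 1) * ∑ i ∈ Finset.range c, (X ^ g) ^ i : K[X]) = 0 := by
    rw [mul_geom_sum, ← pow_mul, ← hg, aeval_frobeniusEnd_X_pow_finrank_sub_one]
  rw [ker_aeval_mul_eq_sup K _ (isCoprime_X_pow_sub_one_geom_sum K g hc) h0]
  have := Submodule.finrank_sup_add_finrank_inf_eq
    (LinearMap.ker (aeval (frobeniusEnd K F) (X ^ h - 1 : K[X])))
    (LinearMap.ker (aeval (frobeniusEnd K F) (X ^ g - 1 : K[X])))
  rw [← ker_aeval_X_pow_gcd_sub_one, finrank_ker_aeval_frobeniusEnd_X_pow_sub_one K F hh,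
    finrank_ker_aeval_frobeniusEnd_X_pow_sub_one K F hgn,
    finrank_ker_aeval_frobeniusEnd_X_pow_sub_one K F ((Nat.gcd_dvd_left h g).trans hh)] at this
  omega

variable (F) in
lemma finrank_ker_aeval_frobeniusEnd_mul_of_dvd {p h g m : ℕ} [Fact p.Prime] [CharP K p]
    (hn : finrank K F = m * p) (hh : h ∣ m) (hg : g ∣ m) :
    finrank K (LinearMap.ker (aeval (frobeniusEnd K F) ((X ^ h - 1) * (X ^ g - 1) : K[X]))) =
      h + g := by
  have hp : p.Prime := Fact.out
  have hm : 0 < m := Nat.pos_of_ne_zero fun h0 => by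
    have : 0 < finrank K F := Module.finrank_pos
    simp [hn, h0] at this
  have ne (d : ℕ) (hd : d ∣ m) : (X ^ d - 1 : K[X]) ≠ 0 :=
    (monic_X_pow_sub_C 1 (Nat.pos_of_dvd_of_pos hd hm).ne').ne_zero
  have deg (d : ℕ) : (X ^ d - 1 : K[X]).natDegree = d := natDegree_X_pow_sub_C
  rw [finrank_ker_aeval_frobeniusEnd_of_dvd K F, natDegree_mul (ne h hh) (ne g hg), deg, deg]
  have : (X ^ finrank K F - 1 : K[X]) = (X ^ m - 1) ^ p := by
    rw [sub_pow_char, one_pow, ← pow_mul, hn]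
  rw [this]
  refine (mul_dvd_mul (dvd_pow_sub_one_of_dvd hh) (dvd_pow_sub_one_of_dvd hg)).trans ?_
  rw [← pow_two]
  exact pow_dvd_pow _ hp.two_le

/-- The radical of `x ↦ Tr (x ^ (q ^ b + 1) - x ^ (q ^ a + 1))` is the kernel of
`(σ ^ (b + a) - 1) (σ ^ (b - a) - 1)` where `σ` is the Frobenius. -/
lemma radicalSet_trace_eq_ker {a b : ℕ} (hab : a < b) {Q : F → K}
    (hQ : ∀ x, Q x = Algebra.trace K F
      (x ^ (Fintype.card K ^ b + 1) - x ^ (Fintype.card K ^ a + 1))) :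
    radicalSet Q = LinearMap.ker
      (aeval (frobeniusEnd K F) ((X ^ (b + a) - 1) * (X ^ (b - a) - 1) : K[X])) := by
  have hpolar (x y : F) : Q (x + y) - Q x - Q y = Algebra.trace K F
      (aeval (frobeniusEnd K F) ((X ^ (b + a) - 1) * (X ^ (b - a) - 1) : K[X]) x *
        (frobeniusEnd K F ^ b) y) := by
    have hpoly : ((X ^ (b + a) - 1) * (X ^ (b - a) - 1) : K[X]) =
        X ^ (b + b) - X ^ (b + a) - X ^ (b - a) + 1 := by
      obtain ⟨c, rfl⟩ := Nat.exists_eq_add_of_lt hab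
      rw [show a + c + 1 - a = c + 1 by omega]
      ring
    have hba : (frobeniusEnd K F ^ b) = (frobeniusEnd K F ^ (b - a)) * frobeniusEnd K F ^ a := by
      rw [← pow_add, Nat.sub_add_cancel hab.le]
    set σ := frobeniusEnd K F with hσ
    have hQ' (z : F) : Q z = Algebra.trace K F ((σ ^ b) z * z - (σ ^ a) z * z) := by
      rw [hQ]; simp only [hσ, frobeniusEnd_pow_apply, pow_succ]
    have e1 : Algebra.trace K F ((σ ^ (b + b)) x * (σ ^ b) y) =
        Algebra.trace K F ((σ ^ b) x * y) := by
      rw [pow_add, Module.End.mul_apply, ← frobeniusEnd_pow_mul, trace_frobeniusEnd_pow]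
    have e2 : Algebra.trace K F ((σ ^ (b + a)) x * (σ ^ b) y) =
        Algebra.trace K F ((σ ^ a) x * y) := by
      rw [pow_add, Module.End.mul_apply, ← frobeniusEnd_pow_mul, trace_frobeniusEnd_pow]
    have e3 : Algebra.trace K F ((σ ^ (b - a)) x * (σ ^ b) y) =
        Algebra.trace K F (x * (σ ^ a) y) := by
      rw [hba, Module.End.mul_apply, ← frobeniusEnd_pow_mul, trace_frobeniusEnd_pow]
    rw [hpoly]
    simp only [hQ', map_add, map_sub, map_pow, aeval_X, map_one, LinearMap.add_apply,
      LinearMap.sub_apply, Module.End.one_apply, add_mul, sub_mul, mul_add, e1, e2, e3]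
    rw [mul_comm ((σ ^ b) y) x, mul_comm ((σ ^ a) y) x]
    ring
  ext x
  simp only [radicalSet, Set.mem_ofPred_eq, hpolar, SetLike.mem_coe, LinearMap.mem_ker]
  refine ⟨fun h => ?_, fun h y => by rw [h, zero_mul, map_zero]⟩
  refine (traceForm_nondegenerate K F).1 _ fun z => ?_
  obtain ⟨y, rfl⟩ := frobeniusEnd_pow_surjective K b z
  exact h y

end Frobenius

/-- The `F_q`-dimension of the radical of `Q_n(x) = Tr_n(x^{q^b+1} − x^{q^a+1})` is
`(b+a, n) + (b−a, n) − ((b+a, b−a), n)` if `ν_p(n) ≤ max{ν_p(b+a), ν_p(b−a)}` and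
`(b+a, n) + (b−a, n)` if `ν_p(n) > max{ν_p(b+a), ν_p(b−a)}`. -/
theorem radical_dimension_two_term
    (p r : ℕ) (hp : p.Prime) (hodd : Odd p) (hr : 0 < r)
    (q : ℕ) (hq : q = p ^ r)
    (a b n : ℕ) (hab : a < b) (hn : 0 < n)
    (K F : Type) [Field K] [Field F] [Fintype K] [Fintype F] [Algebra K F]
    (hcK : Fintype.card K = q) (hcF : Fintype.card F = q ^ n)
    (Qf : F → K)
    (hQf : ∀ x, Qf x = Algebra.trace K F (x ^ (q ^ b + 1) - x ^ (q ^ a + 1)))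
    (w : ℕ) (hw : w = Module.finrank K (Submodule.span K (radicalSet Qf))) :
    (padicValNat p n ≤ max (padicValNat p (b + a)) (padicValNat p (b - a)) →
      w = Nat.gcd (b + a) n + Nat.gcd (b - a) n - Nat.gcd (Nat.gcd (b + a) (b - a)) n) ∧
    (max (padicValNat p (b + a)) (padicValNat p (b - a)) < padicValNat p n →
      w = Nat.gcd (b + a) n + Nat.gcd (b - a) n) := by
  have : Fact p.Prime := ⟨hp⟩
  have hdim : finrank K F = n := by
    have h := Module.card_eq_pow_finrank (K := K) (V := F)
    rw [hcF, hcK] at h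
    have hq1 : 1 < q := hcK ▸ Fintype.one_lt_card
    exact (Nat.pow_right_injective hq1 h).symm
  have : CharP K p := charP_of_card_eq_prime_pow (hcK.trans hq)
  subst hcK
  rw [radicalSet_trace_eq_ker K hab hQf, Submodule.span_eq, ker_aeval_frobeniusEnd_mul_gcd,
    hdim] at hw
  have hhn : (b + a).gcd n ∣ n := Nat.gcd_dvd_right _ _
  have hgn : (b - a).gcd n ∣ n := Nat.gcd_dvd_right _ _
  obtain ⟨c, hc⟩ := id hhn
  obtain ⟨d, hd⟩ := id hgn
  have hpc := hp.dvd_div_gcd_iff_padicValNat_lt (by omega) hn.ne' hc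
  have hpd := hp.dvd_div_gcd_iff_padicValNat_lt (by omega) hn.ne' hd
  refine ⟨fun hv => ?_, fun hv => ?_⟩
  · have hgcd : ((b + a).gcd n).gcd ((b - a).gcd n) = ((b + a).gcd (b - a)).gcd n := by
      refine Nat.dvd_left_iff_eq.1 fun e => ?_
      simp only [Nat.dvd_gcd_iff]
      tauto
    rw [hw, ← hgcd]
    rcases le_max_iff.1 hv with hv | hv
    · rw [mul_comm, finrank_ker_aeval_frobeniusEnd_mul_of_natCast_ne_zero K F (c := c)
        (by rwa [hdim]) (by rwa [hdim]), add_comm, Nat.gcd_comm ((b - a).gcd n)]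
      rw [ne_eq, CharP.cast_eq_zero_iff K p, hpc]
      exact hv.not_gt
    · refine finrank_ker_aeval_frobeniusEnd_mul_of_natCast_ne_zero K F (c := d)
        (by rwa [hdim]) (by rwa [hdim]) ?_
      rw [ne_eq, CharP.cast_eq_zero_iff K p, hpd]
      exact hv.not_gt
  · obtain ⟨hvs, hvt⟩ := max_lt_iff.1 hv
    obtain ⟨k, rfl⟩ := hpc.2 hvs
    obtain ⟨l, rfl⟩ := hpd.2 hvt
    rw [hw]
    refine finrank_ker_aeval_frobeniusEnd_mul_of_dvd K F (p := p) (m := (b + a).gcd n * k)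
      (by rw [hdim, mul_assoc, mul_comm k, ← hc]) ⟨k, rfl⟩ ⟨l, ?_⟩
    refine Nat.eq_of_mul_eq_mul_left hp.pos ?_
    rw [mul_left_comm, ← hc, mul_left_comm, ← hd]
end

section
/- Let b be a positive odd integer. Then the quadratic form Q(x) = Tr_{F_{q^{2pb}}/F_q}(x^{q^b+1} − x^2) on F_{q^{2pb}} has radical of F_q-dimension 2b, and there exists λ ∈ {−1, 1} with #{x ∈ F_{q^{2pb}} : Q(x) = 0} = q^{2pb−1} + λ(q−1)q^{pb+b−1}. (Equivalently, the supersingular curve y^q − y = x^{q^b+1} − x^2 is either maximal or minimal over F_{q^{2pb}}.) -/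
open Module in
theorem Module.End.finrank_ker_mul_le {K V : Type*} [Field K] [AddCommGroup V] [Module K V]
    [FiniteDimensional K V] (f g : Module.End K V) :
    finrank K (LinearMap.ker (f * g)) ≤
      finrank K (LinearMap.ker f) + finrank K (LinearMap.ker g) := by
  let h := g.domRestrict (LinearMap.ker (f * g))
  have hrange : LinearMap.range h ≤ LinearMap.ker f := by
    rintro _ ⟨⟨x, hx⟩, rfl⟩
    exact hx
  have hker : (LinearMap.ker h).map (Submodule.subtype _) ≤ LinearMap.ker g := by
    rintro _ ⟨⟨x, hx⟩, hx', rfl⟩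
    exact hx'
  have h1 := Submodule.finrank_mono hrange
  have h2 := Submodule.finrank_mono hker
  rw [LinearEquiv.finrank_eq (Submodule.equivSubtypeMap _ _).symm] at h2
  have h3 := h.finrank_range_add_finrank_ker
  lia

open Module in
theorem Module.End.finrank_ker_pow_le {K V : Type*} [Field K] [AddCommGroup V] [Module K V]
    [FiniteDimensional K V] (f : Module.End K V) (m : ℕ) :
    finrank K (LinearMap.ker (f ^ m)) ≤ m * finrank K (LinearMap.ker f) := by
  induction m with
  | zero => simp [Module.End.one_eq_id]
  | succ m ih =>
    rw [pow_succ]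
    have := Module.End.finrank_ker_mul_le (f ^ m) f
    lia

/-- For an endomorphism `s` with `s ^ (2 * p) = 1` in characteristic `p`, the kernel of
`(s - 1) ^ 2` is as large as the eigenspace bounds at `1` and `-1` allow. -/
theorem finrank_ker_sub_one_sq {K V : Type*} [Field K] [AddCommGroup V] [Module K V]
    [FiniteDimensional K V] (p b : ℕ) [Fact p.Prime] [CharP K p] (hp : 2 < p)
    (hV : Module.finrank K V = 2 * p * b) (s : Module.End K V) (hs : s ^ (2 * p) = 1)
    (h1 : Module.finrank K (LinearMap.ker (s - 1)) ≤ b)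
    (h2 : Module.finrank K (LinearMap.ker (s + 1)) ≤ b) :
    Module.finrank K (LinearMap.ker ((s - 1) ^ 2)) = 2 * b := by
  obtain ⟨m, rfl⟩ := Nat.exists_eq_add_of_lt hp
  set p := 2 + m + 1
  have hupper := Module.End.finrank_ker_pow_le (s - 1) 2
  rcases Nat.eq_zero_or_pos b with rfl | hb
  · lia
  have : Nontrivial V :=
    Module.nontrivial_of_finrank_pos (R := K) (by rw [hV]; positivity)
  have : CharP (Module.End K V) p := charP_of_injective_algebraMap
    (FaithfulSMul.algebraMap_injective K (Module.End K V)) p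
  have hfac : (s - 1) ^ 2 * ((s - 1) ^ (m + 1) * (s + 1) ^ p) = 0 := by
    rw [← mul_assoc, ← pow_add, show 2 + (m + 1) = p by simp only [p]; ring,
      ← ((Commute.refl s).add_right (Commute.one_right s)).sub_left
        (Commute.one_left _) |>.mul_pow,
      show (s - 1) * (s + 1) = s ^ 2 - 1 by noncomm_ring,
      sub_pow_char_of_commute p (Commute.one_right _), ← pow_mul, hs, one_pow, sub_self]
  have h3 := Module.End.finrank_ker_mul_le ((s - 1) ^ 2) ((s - 1) ^ (m + 1) * (s + 1) ^ p)
  rw [hfac, LinearMap.ker_zero, finrank_top, hV] at h3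
  have h4 := Module.End.finrank_ker_mul_le ((s - 1) ^ (m + 1)) ((s + 1) ^ p)
  have h5 := Module.End.finrank_ker_pow_le (s - 1) (m + 1)
  have h6 := Module.End.finrank_ker_pow_le (s + 1) p
  have h7 := Nat.mul_le_mul_left (m + 1) h1
  have h8 := Nat.mul_le_mul_left p h2
  have h9 : 2 * p * b = 2 * b + ((m + 1) * b + p * b) := by simp only [p]; ring
  lia


/-- A `K`-subspace cut out by an equation `x ^ (#K ^ b) = c x` has dimension at most `b`. -/
theorem finrank_le_of_pow_eq_mul {K F : Type*} [Field K] [Fintype K] [Field F] [Fintype F]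
    [Algebra K F] (b : ℕ) (hb : 0 < b) (c : F) (W : Submodule K F)
    (hW : ∀ x ∈ W, x ^ Fintype.card K ^ b = c * x) :
    Module.finrank K W ≤ b := by
  classical
  let P : Polynomial F :=
    Polynomial.X ^ Fintype.card K ^ b - Polynomial.C c * Polynomial.X
  have hlt : 1 < Fintype.card K ^ b := Nat.one_lt_pow hb.ne' Fintype.one_lt_card
  have hdeg : (Polynomial.C c * Polynomial.X).natDegree < Fintype.card K ^ b :=
    (Polynomial.natDegree_C_mul_le c _).trans_lt (by simpa using hlt)
  have hP : P.natDegree = Fintype.card K ^ b := by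
    rw [Polynomial.natDegree_sub_eq_left_of_natDegree_lt (by simpa using hdeg),
      Polynomial.natDegree_X_pow]
  have hP0 : P ≠ 0 := Polynomial.ne_zero_of_natDegree_gt (n := 0) (by lia)
  have h := Polynomial.card_le_degree_of_subset_roots (p := P)
    (Z := (W : Set F).toFinite.toFinset) fun x hx ↦ by
      have hx' : x ∈ W := by simpa using hx
      rw [Polynomial.mem_roots hP0]
      simp [P, hW x hx']
  rw [hP] at h
  have hcard : (W : Set F).toFinite.toFinset.card = Fintype.card K ^ Module.finrank K W := by
    rw [← Set.ncard_eq_toFinset_card, ← Nat.card_coe_set_eq, ← Nat.card_eq_fintype_card]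
    exact Module.natCard_eq_pow_finrank
  rw [hcard] at h
  exact (Nat.pow_le_pow_iff_right Fintype.one_lt_card).mp h

/-- A quadratic exponential sum over a finite field is a quadratic Gauss sum. -/
theorem AddChar.sum_mul_sq_eq_gaussSum {K : Type*} [Field K] [Fintype K] [DecidableEq K]
    (hK : ringChar K ≠ 2) {R : Type*} [CommRing R] [IsDomain R] {ψ : AddChar K R}
    (hψ : ψ.IsPrimitive) {c : K} (hc : c ≠ 0) :
    ∑ x, ψ (c * x ^ 2) = (quadraticChar K c : R) *
      gaussSum ((quadraticChar K).ringHomComp (Int.castRingHom R)) ψ := by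
  have h1 : ∑ x, ψ (c * x ^ 2) = ∑ y, ((quadraticChar K y + 1 : ℤ) : R) * ψ (c * y) := by
    rw [← Finset.sum_fiberwise (s := Finset.univ) (g := fun x : K ↦ x ^ 2)]
    refine Finset.sum_congr rfl fun y _ ↦ ?_
    rw [← quadraticChar_card_sqrts hK y, Finset.sum_congr rfl (g := fun _ ↦ ψ (c * y))
      (fun x hx ↦ by rw [(Finset.mem_filter.mp hx).2]), Finset.sum_const, nsmul_eq_mul]
    rw [Int.cast_natCast]
    congr 3
    ext
    simp
  have h2 : ∑ y, ψ (c * y) = 0 := by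
    simp_rw [mul_comm c]
    rw [AddChar.sum_mulShift c hψ, if_neg hc, Nat.cast_zero]
  rw [h1]
  push_cast
  simp_rw [add_mul, one_mul]
  rw [Finset.sum_add_distrib, h2, add_zero, ← gaussSum_mulShift _ ψ (Units.mk0 c hc), ← mul_assoc]
  have h3 := quadraticChar_sq_one hc
  have h4 : ((quadraticChar K c : ℤ) : R) * (quadraticChar K c : ℤ) = 1 := by
    rw [← sq, ← Int.cast_pow, h3, Int.cast_one]
  rw [MulChar.ringHomComp_apply, eq_intCast, Units.val_mk0, h4, one_mul]
  simp [gaussSum, AddChar.mulShift_apply]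

theorem AddChar.map_sum_eq_prod {A M ι : Type*} [AddCommMonoid A] [CommMonoid M]
    (ψ : AddChar A M) (s : Finset ι) (f : ι → A) : ψ (∑ i ∈ s, f i) = ∏ i ∈ s, ψ (f i) := by
  induction s using Finset.cons_induction with
  | empty => simp
  | cons i s hi ih => rw [Finset.sum_cons, Finset.prod_cons, AddChar.map_add_eq_mul, ih]

/-- The number of zeros of a diagonal quadratic form of even rank over a finite field. -/
theorem card_zeros_weightedSumSquares {K ι : Type*} [Field K] [Fintype K] [Fintype ι]
    (hK : ringChar K ≠ 2) (w : ι → K) (z k : ℕ) (hz : {i | w i = 0}.ncard = z)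
    (hι : Fintype.card ι = z + 2 * k) :
    ∃ lam : ℤ, (lam = 1 ∨ lam = -1) ∧
      (Fintype.card K : ℤ) * ({x | QuadraticMap.weightedSumSquares K w x = 0}.ncard : ℤ) =
        (Fintype.card K : ℤ) ^ Fintype.card ι +
          lam * (Fintype.card K - 1) * (Fintype.card K : ℤ) ^ (z + k) := by
  classical
  obtain ⟨ψ, hψ⟩ : ∃ ψ : AddChar K ℂ, ψ.IsPrimitive :=
    ⟨_, AddChar.FiniteField.primitiveChar_to_Complex_isPrimitive K⟩
  set q := Fintype.card K with hq
  set χ := (quadraticChar K).ringHomComp (Int.castRingHom ℂ) with hχ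
  set s := Finset.univ.filter fun i ↦ w i ≠ 0 with hs
  have hs0 : (Finset.univ.filter fun i ↦ w i = 0).card = z := by
    rw [← hz, Set.ncard_eq_toFinset_card']
    congr 1
    ext
    simp
  have hscard : s.card = 2 * k := by
    have := Finset.card_filter_add_card_filter_not (s := (Finset.univ : Finset ι))
      (fun i ↦ w i = 0)
    rw [hs0, Finset.card_univ, hι] at this
    simpa [hs] using this
  let lam : ℤ := (∏ i ∈ s, quadraticChar K (w i)) * quadraticChar K (-1) ^ k
  have hsq1 : ∀ {a : K}, a ≠ 0 → IsUnit (quadraticChar K a) := fun ha ↦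
    Int.isUnit_iff.mpr (quadraticChar_dichotomy ha)
  have hlam : lam = 1 ∨ lam = -1 := by
    rw [← Int.isUnit_iff]
    refine IsUnit.mul ?_ ((hsq1 (neg_ne_zero.mpr one_ne_zero)).pow k)
    exact Finset.prod_induction _ IsUnit (fun _ _ ↦ IsUnit.mul) isUnit_one
      fun i hi ↦ hsq1 (Finset.mem_filter.mp hi).2
  have hg : gaussSum χ ψ ^ 2 = ((quadraticChar K (-1) : ℤ) : ℂ) * q := by
    refine gaussSum_sq ?_ ((quadraticChar_isQuadratic K).comp _) hψ
    exact (MulChar.ringHomComp_ne_one_iff (RingHom.injective_int _)).mpr (quadraticChar_ne_one hK)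
  have hS : ∀ a : K, a ≠ 0 →
      ∑ x : ι → K, ψ (a * QuadraticMap.weightedSumSquares K w x) = lam * (q : ℂ) ^ (z + k) := by
    intro a ha
    have hfac : ∀ x : ι → K, ψ (a * QuadraticMap.weightedSumSquares K w x) =
        ∏ i, ψ (a * w i * x i ^ 2) := fun x ↦ by
      rw [QuadraticMap.weightedSumSquares_apply, Finset.mul_sum, AddChar.map_sum_eq_prod]
      simp [sq, mul_assoc]
    simp_rw [hfac]
    rw [← Fintype.prod_sum (fun i y ↦ ψ (a * w i * y ^ 2)),
      ← Finset.prod_filter_mul_prod_filter_not Finset.univ (fun i ↦ w i = 0),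
      Finset.prod_congr rfl (g := fun _ ↦ (q : ℂ))
        (fun i hi ↦ by simp [(Finset.mem_filter.mp hi).2, hq]),
      Finset.prod_const, hs0,
      Finset.prod_congr rfl (g := fun i ↦ ((quadraticChar K a : ℤ) : ℂ) *
          ((quadraticChar K (w i) : ℤ) : ℂ) * gaussSum χ ψ)
        (fun i hi ↦ by
          rw [AddChar.sum_mul_sq_eq_gaussSum hK hψ (mul_ne_zero ha (Finset.mem_filter.mp hi).2),
            map_mul, Int.cast_mul]),
      Finset.prod_mul_distrib, Finset.prod_mul_distrib, Finset.prod_const, Finset.prod_const]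
    change _ * (_ ^ s.card * (∏ i ∈ s, _) * _ ^ s.card) = _
    have ha2 : ((quadraticChar K a : ℤ) : ℂ) ^ 2 = 1 := by exact_mod_cast quadraticChar_sq_one ha
    rw [hscard, pow_mul, pow_mul, hg, ha2]
    simp only [lam]
    push_cast
    ring
  refine ⟨lam, hlam, ?_⟩
  have hcount : (q : ℂ) * ({x | QuadraticMap.weightedSumSquares K w x = 0}.ncard : ℂ) =
      ∑ a : K, ∑ x : ι → K, ψ (a * QuadraticMap.weightedSumSquares K w x) := by
    rw [Finset.sum_comm]
    simp_rw [AddChar.sum_mulShift _ hψ]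
    push_cast
    rw [← Finset.sum_filter, Finset.sum_const, nsmul_eq_mul, mul_comm,
      Set.ncard_eq_toFinset_card']
    congr 3
    ext
    simp
  have hmain : (q : ℂ) * ({x | QuadraticMap.weightedSumSquares K w x = 0}.ncard : ℂ) =
      (q : ℂ) ^ Fintype.card ι + lam * (q - 1) * (q : ℂ) ^ (z + k) := by
    rw [hcount, ← Finset.add_sum_erase _ _ (Finset.mem_univ (0 : K)),
      Finset.sum_congr rfl (fun a ha ↦ hS a (Finset.ne_of_mem_erase ha)), Finset.sum_const,
      Finset.card_erase_of_mem (Finset.mem_univ _), Finset.card_univ, nsmul_eq_mul,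
      Nat.cast_pred Fintype.card_pos]
    simp only [zero_mul, AddChar.map_zero_eq_one, Finset.sum_const, Finset.card_univ,
      nsmul_eq_mul, mul_one, Fintype.card_fun]
    push_cast
    ring
  exact_mod_cast hmain

/-- The number of zeros of a quadratic form whose radical has even codimension, over a finite
field of odd characteristic. -/
theorem QuadraticForm.card_zeros {K V : Type*} [Field K] [Fintype K] [AddCommGroup V] [Module K V]
    [FiniteDimensional K V] (hK : ringChar K ≠ 2) (Q : QuadraticForm K V) (k : ℕ)
    (hk : Module.finrank K V = Module.finrank K Q.radical + 2 * k) :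
    ∃ lam : ℤ, (lam = 1 ∨ lam = -1) ∧
      (Fintype.card K : ℤ) * ({x | Q x = 0}.ncard : ℤ) =
        (Fintype.card K : ℤ) ^ Module.finrank K V +
          lam * (Fintype.card K - 1) *
            (Fintype.card K : ℤ) ^ (Module.finrank K Q.radical + k) := by
  have : NeZero (2 : K) := ⟨Ring.two_ne_zero hK⟩
  have : Invertible (2 : K) := invertibleOfNonzero (NeZero.ne _)
  obtain ⟨w, hw⟩ := Q.equivalent_weightedSumSquares
  obtain ⟨lam, hlam, h⟩ := card_zeros_weightedSumSquares hK w _ k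
    (QuadraticForm.finrank_radical_of_equiv_weightedSumSquares hw).symm
    ((Fintype.card_fin _).trans hk)
  refine ⟨lam, hlam, ?_⟩
  obtain ⟨e⟩ := hw
  rw [Fintype.card_fin] at h
  rw [← h, ← Set.ncard_image_of_injective {x | Q x = 0} e.injective]
  congr 3
  ext y
  constructor
  · rintro ⟨x, hx, rfl⟩
    exact (e.map_app x).trans hx
  · intro hy
    exact ⟨e.symm y, (e.symm.map_app y).trans hy, e.apply_symm_apply y⟩

/-- The `q ^ b`-power Frobenius of a finite extension of a field with `q` elements. -/
noncomputable def frobeniusPow (K F : Type*) [Field K] [Fintype K] [Field F] [Finite F]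
    [Algebra K F] (b : ℕ) : F ≃ₐ[K] F :=
  FiniteField.frobeniusAlgEquivOfAlgebraic K F ^ b

theorem frobeniusPow_apply {K F : Type*} [Field K] [Fintype K] [Field F] [Finite F]
    [Algebra K F] (b : ℕ) (x : F) : frobeniusPow K F b x = x ^ Fintype.card K ^ b := by
  rw [frobeniusPow, AlgEquiv.coe_pow, FiniteField.coe_frobeniusAlgEquivOfAlgebraic_iterate]

/-- The quadratic form `x ↦ Tr (x ^ (q ^ b + 1) - x ^ 2)`. -/
noncomputable def traceQuadraticForm (K F : Type*) [Field K] [Fintype K] [Field F] [Finite F]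
    [Algebra K F] (b : ℕ) : QuadraticForm K F :=
  LinearMap.BilinMap.toQuadraticMap
    ((Algebra.traceForm K F).compl₂ ((frobeniusPow K F b).toLinearMap - 1))

theorem traceQuadraticForm_apply {K F : Type*} [Field K] [Fintype K] [Field F] [Finite F]
    [Algebra K F] (b : ℕ) (x : F) :
    traceQuadraticForm K F b x = Algebra.trace K F (x ^ (Fintype.card K ^ b + 1) - x ^ 2) := by
  rw [traceQuadraticForm, LinearMap.BilinMap.toQuadraticMap_apply, LinearMap.compl₂_apply,
    Algebra.traceForm_apply]
  congr 1
  simp [frobeniusPow_apply]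
  ring

/-- The polar form of `traceQuadraticForm` is `Tr ((σ - 1)² x * σ y)`, `σ` the `q ^ b`-power
Frobenius. -/
theorem polar_traceQuadraticForm {K F : Type*} [Field K] [Fintype K] [Field F] [Finite F]
    [Algebra K F] (b : ℕ) (x y : F) :
    QuadraticMap.polar (traceQuadraticForm K F b) x y =
      Algebra.trace K F ((((frobeniusPow K F b).toLinearMap - 1 : Module.End K F) ^ 2) x *
        frobeniusPow K F b y) := by
  set σ := frobeniusPow K F b
  have h : ∀ z, Algebra.trace K F (σ z) = Algebra.trace K F z :=
    Algebra.trace_eq_of_algEquiv σ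
  have hp : QuadraticMap.polar (traceQuadraticForm K F b) x y =
      Algebra.trace K F (x * (σ y - y)) + Algebra.trace K F (y * (σ x - x)) := by
    rw [traceQuadraticForm, LinearMap.BilinMap.polar_toQuadraticMap]
    rfl
  rw [hp, ← h (y * (σ x - x)), mul_sub, map_sub, ← h (x * y), ← map_sub, ← map_add]
  congr 1
  simp [sq]
  ring

theorem radicalSet_traceQuadraticForm {K F : Type*} [Field K] [Fintype K] [Field F] [Finite F]
    [Algebra K F] (b : ℕ) :
    radicalSet (traceQuadraticForm K F b) = (LinearMap.ker
      (((frobeniusPow K F b).toLinearMap - 1 : Module.End K F) ^ 2) : Set F) := by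
  ext x
  simp only [radicalSet, SetLike.mem_coe, LinearMap.mem_ker]
  change (∀ y, QuadraticMap.polar (traceQuadraticForm K F b) x y = 0) ↔ _
  simp_rw [polar_traceQuadraticForm]
  constructor
  · intro h
    refine (traceForm_nondegenerate K F).1 _ fun y ↦ ?_
    simpa using h ((frobeniusPow K F b).symm y)
  · intro h y
    rw [h, zero_mul, map_zero]

theorem radical_traceQuadraticForm {K F : Type*} [Field K] [Fintype K] [Field F] [Finite F]
    [Algebra K F] (b : ℕ) (hK : ringChar K ≠ 2) :
    (traceQuadraticForm K F b).radical = LinearMap.ker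
      (((frobeniusPow K F b).toLinearMap - 1 : Module.End K F) ^ 2) := by
  have : Invertible (2 : K) := invertibleOfNonzero (Ring.two_ne_zero hK)
  apply SetLike.coe_injective
  rw [QuadraticMap.radical_eq_ker_polarBilin, ← radicalSet_traceQuadraticForm]
  ext x
  exact LinearMap.ext_iff (f := (traceQuadraticForm K F b).polarBilin x) (g := 0)

theorem finrank_ker_frobeniusPow_sub_one_sq {K F : Type*} [Field K] [Fintype K] [Field F]
    [Fintype F] [Algebra K F] (p b : ℕ) [Fact p.Prime] [CharP K p] (hp : 2 < p) (hb : 0 < b)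
    (hF : Module.finrank K F = 2 * p * b) :
    Module.finrank K (LinearMap.ker
      (((frobeniusPow K F b).toLinearMap - 1 : Module.End K F) ^ 2)) = 2 * b := by
  refine finrank_ker_sub_one_sq p b hp hF _ ?_ ?_ ?_
  · ext x
    have : (frobeniusPow K F b) ^ (2 * p) = 1 := by
      rw [frobeniusPow, ← pow_mul, mul_comm, ← hF,
        ← FiniteField.orderOf_frobeniusAlgEquivOfAlgebraic, pow_orderOf_eq_one]
    simpa [Module.End.pow_apply, AlgEquiv.coe_pow] using DFunLike.congr_fun this x
  · refine finrank_le_of_pow_eq_mul b hb 1 _ fun x hx ↦ ?_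
    rw [← frobeniusPow_apply, one_mul]
    simpa [sub_eq_zero] using hx
  · refine finrank_le_of_pow_eq_mul b hb (-1) _ fun x hx ↦ ?_
    rw [← frobeniusPow_apply, neg_one_mul, ← add_eq_zero_iff_eq_neg]
    simpa using hx

/-- For odd `b`, the quadratic form `Q(x) = Tr_{F_{q^{2pb}}/F_q}(x^{q^b+1} − x^2)` has
radical of `F_q`-dimension `2b`, and there is `λ ∈ {−1,1}` with
`#{x : Q(x) = 0} = q^{2pb−1} + λ(q−1)q^{pb+b−1}`; i.e. the curve
`y^q − y = x^{q^b+1} − x^2` is maximal or minimal over `F_{q^{2pb}}`. -/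
theorem maximal_or_minimal_over_2pb
    (p r : ℕ) (hp : p.Prime) (hodd : Odd p) (hr : 0 < r)
    (q : ℕ) (hq : q = p ^ r)
    (b n : ℕ) (hb : 0 < b) (hbodd : Odd b) (hn : n = 2 * p * b)
    (K F : Type) [Field K] [Field F] [Fintype K] [Fintype F] [Algebra K F]
    (hcK : Fintype.card K = q) (hcF : Fintype.card F = q ^ n)
    (Qf : F → K)
    (hQf : ∀ x, Qf x = Algebra.trace K F (x ^ (q ^ b + 1) - x ^ 2)) :
    Module.finrank K (Submodule.span K (radicalSet Qf)) = 2 * b ∧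
    ∃ lam : ℤ, (lam = 1 ∨ lam = -1) ∧
      ({x : F | Qf x = 0}.ncard : ℤ) =
        q ^ (n - 1) + lam * (q - 1) * q ^ (p * b + b - 1) := by
  have : Fact p.Prime := ⟨hp⟩
  have hp2 : 2 < p := by
    have := hp.two_le
    rcases hodd with ⟨m, rfl⟩
    lia
  have hcp : CharP K p := charP_of_card_eq_prime_pow (hcK.trans hq)
  have hK : ringChar K ≠ 2 := by
    rw [ringChar.eq K p]
    exact hp2.ne'
  have hF : Module.finrank K F = 2 * p * b := by
    rw [← hn]
    refine Nat.pow_right_injective (hcK ▸ Fintype.one_lt_card : 1 < q) ?_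
    simp only
    rw [← hcF, ← hcK, ← Module.card_eq_pow_finrank]
  obtain rfl : Qf = traceQuadraticForm K F b :=
    funext fun x ↦ by rw [hQf, traceQuadraticForm_apply, hcK]
  have hrad := finrank_ker_frobeniusPow_sub_one_sq (K := K) (F := F) p b hp2 hb hF
  refine ⟨by rw [radicalSet_traceQuadraticForm, Submodule.span_eq, hrad], ?_⟩
  obtain ⟨m, hm⟩ : ∃ m, p = m + 1 := ⟨p - 1, by lia⟩
  rw [← radical_traceQuadraticForm b hK] at hrad
  obtain ⟨lam, hlam, h⟩ := QuadraticForm.card_zeros hK (traceQuadraticForm K F b) (m * b)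
    (by rw [hrad, hF, hm]; ring)
  refine ⟨lam, hlam, ?_⟩
  have hq0 : (q : ℤ) ≠ 0 := by
    rw [← hcK]
    exact_mod_cast Fintype.card_ne_zero
  apply mul_left_cancel₀ hq0
  have hpb : 0 < p * b := Nat.mul_pos hp.pos hb
  rw [hcK, hrad, hF, ← hn] at h
  have hn1 : n = n - 1 + 1 := (Nat.sub_add_cancel (by rw [hn, mul_assoc]; lia)).symm
  have he : 2 * b + m * b = p * b + b - 1 + 1 := by
    rw [Nat.sub_add_cancel (by lia), hm]
    ring
  rw [h, he, pow_succ (q : ℤ) (p * b + b - 1), congrArg ((q : ℤ) ^ ·) hn1, pow_succ]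
  ring
end
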